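/- arXiv:2604.02229 — 11 statements merged into one kernel-verified Lean document; each statement's English description precedes it below -/
import Mathlib

section
/- Let 1 < p < ∞. Let v and w be non-negative real-valued functions on ℕ = {1,2,...} and let φ : ℕ₀ → [0,∞) be positive and non-decreasing on ℕ with φ(0) = 0, such that for every n ≥ 1: v(n)·(φ(n) − φ(n−1))^{p−1} − v(n+1)·(φ(n+1) − φ(n))^{p−1} ≥ w(n)·φ(n)^{p−1}. Then for every finitely supported sequence u : ℕ₀ → ℂ with u(0) = 0, one has ∑_{n=1}^∞ v(n)|u(n) − u(n−1)|^p ≥ ∑_{n=1}^∞ w(n)|u(n)|^p + ∑_{n=2}^∞ v(n)·R_p(u(n), φ(n)). -/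
open Complex

/-- The `C_p`-functional: `C_p(ξ,η) = |ξ|^p - |ξ-η|^p - p|ξ-η|^{p-2} Re((ξ-η)·conj η)`. -/
noncomputable def Cp (p : ℝ) (ξ η : ℂ) : ℝ :=
  ‖ξ‖ ^ p - ‖ξ - η‖ ^ p - p * ‖ξ - η‖ ^ (p - 2) * ((ξ - η) * (starRingEnd ℂ) η).re

/-- The remainder term `R_p(u(n), φ(n))` (used for `n ≥ 2`). -/
noncomputable def Rp (p : ℝ) (φ : ℕ → ℝ) (u : ℕ → ℂ) (n : ℕ) : ℝ :=
  Cp p (u n - u (n - 1)) (((φ (n - 1) / φ n : ℝ) : ℂ) * u n - u (n - 1))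
    + φ (n - 1) * (φ n - φ (n - 1)) ^ (p - 1) *
      Cp p (u (n - 1) / ((φ (n - 1) : ℝ) : ℂ))
        (u (n - 1) / ((φ (n - 1) : ℝ) : ℂ) - u n / ((φ n : ℝ) : ℂ))

/-- The first `C_p`-term of the remainder, expanded. -/
theorem Cp_sub_div_mul_sub (p : ℝ) {f g : ℝ} (hf : 0 < f) (hgf : g ≤ f) (hp : 1 < p) (a b : ℂ) :
    Cp p (a - b) (((g / f : ℝ) : ℂ) * a - b) =
      ‖a - b‖ ^ p - (f - g) ^ p / f ^ p * ‖a‖ ^ p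
        - p * ((f - g) ^ (p - 1) / f ^ (p - 1)) * ‖a‖ ^ (p - 2)
          * (g / f * ‖a‖ ^ 2 - (a * (starRingEnd ℂ) b).re) := by
  have hd : 0 ≤ f - g := sub_nonneg.2 hgf
  have hdf : 0 ≤ (f - g) / f := div_nonneg hd hf.le
  have hsub : a - b - (((g / f : ℝ) : ℂ) * a - b) = (((f - g) / f : ℝ) : ℂ) * a := by
    have hf' : (f : ℂ) ≠ 0 := by exact_mod_cast hf.ne'
    push_cast
    field_simp
    ring
  have hnorm : ‖(((f - g) / f : ℝ) : ℂ) * a‖ = (f - g) / f * ‖a‖ := by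
    rw [norm_mul, Complex.norm_real, Real.norm_of_nonneg hdf]
  have hre : ((((f - g) / f : ℝ) : ℂ) * a *
      (starRingEnd ℂ) (((g / f : ℝ) : ℂ) * a - b)).re =
        (f - g) / f * (g / f * ‖a‖ ^ 2 - (a * (starRingEnd ℂ) b).re) := by
    rw [Complex.sq_norm, Complex.normSq_apply, mul_assoc, Complex.re_ofReal_mul]
    simp only [map_sub, map_mul, Complex.conj_ofReal, Complex.mul_re, Complex.sub_re,
      Complex.sub_im, Complex.mul_im, Complex.conj_re, Complex.conj_im, Complex.ofReal_re,
      Complex.ofReal_im]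
    ring
  have hpow : ((f - g) / f) ^ (p - 2) * ((f - g) / f) = ((f - g) / f) ^ (p - 1) := by
    rw [← Real.rpow_add_one' hdf (by linarith)]
    ring_nf
  rw [Cp, hsub, hnorm, hre, Real.mul_rpow hdf (norm_nonneg a), Real.mul_rpow hdf (norm_nonneg a),
    ← Real.div_rpow hd hf.le, ← Real.div_rpow hd hf.le, ← hpow]
  ring

/-- The second `C_p`-term of the remainder, expanded. -/
theorem Cp_div_div_sub_div (p : ℝ) {f g : ℝ} (hf : 0 < f) (hg : 0 < g) (a b : ℂ) :
    Cp p (b / (g : ℂ)) (b / (g : ℂ) - a / (f : ℂ)) =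
      ‖b‖ ^ p / g ^ p - ‖a‖ ^ p / f ^ p
        - p * (‖a‖ ^ (p - 2) / f ^ (p - 1))
          * ((a * (starRingEnd ℂ) b).re / g - ‖a‖ ^ 2 / f) := by
  have hnorm (z : ℂ) {r : ℝ} (hr : 0 < r) : ‖z / (r : ℂ)‖ = ‖z‖ / r := by
    rw [norm_div, Complex.norm_real, Real.norm_of_nonneg hr.le]
  have hre : (a / (f : ℂ) * (starRingEnd ℂ) (b / (g : ℂ) - a / (f : ℂ))).re =
      ((a * (starRingEnd ℂ) b).re / g - ‖a‖ ^ 2 / f) / f := by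
    rw [Complex.sq_norm, Complex.normSq_apply]
    simp only [map_sub, map_div₀, Complex.conj_ofReal, Complex.mul_re, Complex.sub_re,
      Complex.sub_im, Complex.div_ofReal_re, Complex.div_ofReal_im, Complex.conj_re,
      Complex.conj_im]
    field_simp
    ring
  have hpow : f ^ (p - 1) = f ^ (p - 2) * f := by
    rw [← Real.rpow_add_one hf.ne']
    ring_nf
  rw [Cp, sub_sub_cancel, hnorm b hg, hnorm a hf, hre, Real.div_rpow (norm_nonneg b) hg.le,
    Real.div_rpow (norm_nonneg a) hf.le, Real.div_rpow (norm_nonneg a) hf.le, hpow]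
  have := (Real.rpow_pos_of_pos hf (p - 2)).ne'
  field_simp

/-- The cross terms in the remainder cancel, leaving a telescoping expression. -/
theorem Rp_succ_eq (p : ℝ) (hp : 1 < p) (φ : ℕ → ℝ) (u : ℕ → ℂ) (n : ℕ)
    (hpos : 0 < φ n) (hmono : φ n ≤ φ (n + 1)) :
    Rp p φ u (n + 1) =
      ‖u (n + 1) - u n‖ ^ p
        - (φ (n + 1) - φ n) ^ (p - 1) * (‖u (n + 1)‖ ^ p / φ (n + 1) ^ (p - 1))
        + (φ (n + 1) - φ n) ^ (p - 1) * (‖u n‖ ^ p / φ n ^ (p - 1)) := by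
  have hpos' : 0 < φ (n + 1) := hpos.trans_le hmono
  have hpow {x : ℝ} (hx : 0 ≤ x) : x ^ p = x ^ (p - 1) * x := by
    rw [← Real.rpow_add_one' hx (by linarith), sub_add_cancel]
  rw [Rp, Nat.add_sub_cancel, Cp_sub_div_mul_sub p hpos' hmono hp,
    Cp_div_div_sub_div p hpos' hpos, hpow (sub_nonneg.2 hmono), hpow hpos.le, hpow hpos'.le]
  have h1 := (Real.rpow_pos_of_pos hpos (p - 1)).ne'
  have h2 := (Real.rpow_pos_of_pos hpos' (p - 1)).ne'
  field_simp
  ring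

/-- The Hardy inequality for partial sums, with a boundary term. -/
theorem sum_range_hardy_remainder_le
    (p : ℝ) (hp : 1 < p) (v w : ℕ → ℝ)
    (φ : ℕ → ℝ) (hφ0 : φ 0 = 0) (hφpos : ∀ n, 1 ≤ n → 0 < φ n)
    (hφmono : ∀ n, 1 ≤ n → φ n ≤ φ (n + 1))
    (hcond : ∀ n, 1 ≤ n →
      w n * φ n ^ (p - 1) ≤
        v n * (φ n - φ (n - 1)) ^ (p - 1) - v (n + 1) * (φ (n + 1) - φ n) ^ (p - 1))
    (u : ℕ → ℂ) (hu0 : u 0 = 0) (N : ℕ) :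
    (∑ n ∈ Finset.range N, w (n + 1) * ‖u (n + 1)‖ ^ p)
        + (∑ n ∈ Finset.range N, v (n + 2) * Rp p φ u (n + 2))
        + v (N + 1) * (φ (N + 1) - φ N) ^ (p - 1) * (‖u (N + 1)‖ ^ p / φ (N + 1) ^ (p - 1))
      ≤ ∑ n ∈ Finset.range (N + 1), v (n + 1) * ‖u (n + 1) - u n‖ ^ p := by
  induction N with
  | zero =>
    have h := (Real.rpow_pos_of_pos (hφpos 1 le_rfl) (p - 1)).ne'
    simp only [Finset.range_zero, Finset.sum_empty, zero_add, Finset.sum_range_one, hφ0, hu0,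
      sub_zero]
    field_simp
    exact le_rfl
  | succ N ih =>
    have hpos := hφpos (N + 1) (by omega)
    have hpow := Real.rpow_pos_of_pos hpos (p - 1)
    have hstep := mul_le_mul_of_nonneg_right (hcond (N + 1) (by omega))
      (div_nonneg (Real.rpow_nonneg (norm_nonneg (u (N + 1))) p) hpow.le)
    rw [mul_assoc, mul_div_cancel₀ _ hpow.ne', Nat.add_sub_cancel] at hstep
    rw [Finset.sum_range_succ, Finset.sum_range_succ _ N, Finset.sum_range_succ _ (N + 1),
      Rp_succ_eq p hp φ u (N + 1) hpos (hφmono (N + 1) (by omega))]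
    linarith

/-- General weighted discrete `p`-Hardy inequality with sharp remainder term. -/
theorem general_weighted_discrete_p_hardy_with_remainder
    (p : ℝ) (hp : 1 < p) (v w : ℕ → ℝ)
    (hv : ∀ n, 1 ≤ n → 0 ≤ v n) (hw : ∀ n, 1 ≤ n → 0 ≤ w n)
    (φ : ℕ → ℝ) (hφ0 : φ 0 = 0) (hφpos : ∀ n, 1 ≤ n → 0 < φ n)
    (hφmono : ∀ n, 1 ≤ n → φ n ≤ φ (n + 1))
    (hcond : ∀ n, 1 ≤ n →
      w n * φ n ^ (p - 1) ≤
        v n * (φ n - φ (n - 1)) ^ (p - 1) - v (n + 1) * (φ (n + 1) - φ n) ^ (p - 1))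
    (u : ℕ → ℂ) (hu : (Function.support u).Finite) (hu0 : u 0 = 0) :
    (∑' n : ℕ, w (n + 1) * ‖u (n + 1)‖ ^ p)
        + (∑' n : ℕ, v (n + 2) * Rp p φ u (n + 2))
      ≤ ∑' n : ℕ, v (n + 1) * ‖u (n + 1) - u n‖ ^ p := by
  obtain ⟨N, hN⟩ := hu.bddAbove
  have hzero : ∀ n, N < n → u n = 0 := fun n hn => by
    by_contra h
    exact absurd (hN h) (by omega)
  have hp0 : p ≠ 0 := by linarith
  have hR : ∀ n, N < n → Rp p φ u (n + 2) = 0 := fun n hn => by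
    rw [Rp_succ_eq p hp φ u (n + 1) (hφpos _ (by omega)) (hφmono _ (by omega)),
      hzero (n + 1) (by omega), hzero (n + 1 + 1) (by omega)]
    simp [Real.zero_rpow hp0]
  have hmain := sum_range_hardy_remainder_le p hp v w φ hφ0 hφpos hφmono hcond u hu0 (N + 1)
  rw [tsum_eq_sum (s := Finset.range (N + 1)), tsum_eq_sum (s := Finset.range (N + 1)),
    tsum_eq_sum (s := Finset.range (N + 1 + 1))]
  · rw [hzero (N + 1 + 1) (by omega)] at hmain
    simpa [Real.zero_rpow hp0] using hmain
  · intro n hn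
    rw [Finset.mem_range] at hn
    rw [hzero n (by omega), hzero (n + 1) (by omega)]
    simp [Real.zero_rpow hp0]
  · intro n hn
    rw [Finset.mem_range] at hn
    rw [hR n (by omega), mul_zero]
  · intro n hn
    rw [Finset.mem_range] at hn
    rw [hzero (n + 1) (by omega)]
    simp [Real.zero_rpow hp0]
end

section
/- Let 1 < p < ∞, let v : ℕ → ℝ satisfy v(n) ≥ 0 for all n ∈ ℕ, and let φ : ℕ₀ → ℝ satisfy φ(n+1) ≥ φ(n) > 0 for all n ∈ ℕ and φ(0) = 0. Then for every finitely supported sequence u : ℕ₀ → ℂ with u(0) = 0, one has ∑_{n=1}^∞ v(n)|∇u(n)|^p ≥ − ∑_{n=1}^∞ (div(v(n)·(∇φ(n))^{p−1}) / φ(n)^{p−1})·|u(n)|^p, where ∇f(n) := f(n) − f(n−1) and div h(n) := h(n+1) − h(n). -/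
open Complex

/-- Convexity of the perspective function `(s, t) ↦ s ^ p / t ^ (p - 1)`, in subadditive form. -/
lemma rpow_add_div_rpow_sub_one_le {p : ℝ} (hp : 1 < p) {c a s x : ℝ} (hc : 0 ≤ c) (ha : 0 ≤ a)
    (hs : 0 < s) (hx : 0 < x) :
    (c + a) ^ p / (s + x) ^ (p - 1) ≤ c ^ p / s ^ (p - 1) + a ^ p / x ^ (p - 1) := by
  have perspective : ∀ {z t : ℝ}, 0 ≤ z → 0 < t → z ^ p / t ^ (p - 1) = t * (z / t) ^ p := by
    intro z t hz ht
    rw [Real.div_rpow hz ht.le, Real.rpow_sub_one ht.ne']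
    have := (Real.rpow_pos_of_pos ht p).ne'
    field_simp
  have hsx : 0 < s + x := by positivity
  rw [perspective (add_nonneg hc ha) hsx, perspective hc hs, perspective ha hx]
  have jensen := (convexOn_rpow hp.le).2
    (Set.mem_Ici.2 (by positivity : 0 ≤ c / s)) (Set.mem_Ici.2 (by positivity : 0 ≤ a / x))
    (by positivity : 0 ≤ s / (s + x)) (by positivity : 0 ≤ x / (s + x)) (by field_simp)
  simp only [smul_eq_mul] at jensen
  have mean : s / (s + x) * (c / s) + x / (s + x) * (a / x) = (c + a) / (s + x) := by
    field_simp
  rw [mean] at jensen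
  calc (s + x) * ((c + a) / (s + x)) ^ p
      ≤ (s + x) * (s / (s + x) * (c / s) ^ p + x / (s + x) * (a / x) ^ p) := by gcongr
    _ = s * (c / s) ^ p + x * (a / x) ^ p := by field_simp

/-- Discrete Picone inequality. -/
lemma rpow_sub_mul_picone_le {p : ℝ} (hp : 1 < p) {a b c x y : ℝ} (ha : 0 ≤ a) (hb : 0 ≤ b)
    (hc : 0 ≤ c) (hbc : b ≤ c + a) (hx : 0 ≤ x) (hxy : x ≤ y) (hxa : x = 0 → a = 0) :
    (y - x) ^ (p - 1) * (b ^ p / y ^ (p - 1) - a ^ p / x ^ (p - 1)) ≤ c ^ p := by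
  rcases hxy.eq_or_lt with rfl | hlt
  · rw [sub_self, Real.zero_rpow (by linarith), zero_mul]
    positivity
  have hbp : b ^ p ≤ (c + a) ^ p := Real.rpow_le_rpow hb hbc (by linarith)
  rcases hx.eq_or_lt with rfl | hx0
  · rw [hxa rfl, add_zero] at hbp
    rw [hxa rfl, sub_zero, Real.zero_rpow (by linarith : p ≠ 0), zero_div, sub_zero,
      mul_div_cancel₀ _ (Real.rpow_pos_of_pos hlt _).ne']
    exact hbp
  have hs : 0 < y - x := sub_pos.2 hlt
  have key := rpow_add_div_rpow_sub_one_le hp hc ha hs hx0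
  rw [sub_add_cancel] at key
  have hy : 0 < y := hx0.trans hlt
  have hdiv : b ^ p / y ^ (p - 1) ≤ (c + a) ^ p / y ^ (p - 1) := by gcongr
  rw [mul_comm, ← le_div_iff₀ (Real.rpow_pos_of_pos hs _)]
  linarith

/-- Štampach–Waclawek general weighted discrete `p`-Hardy inequality:
`∑ v(n)|∇u(n)|^p ≥ -∑ (div(v(n)(∇φ(n))^{p-1}) / φ(n)^{p-1}) |u(n)|^p`,
where `∇f(n) = f(n) - f(n-1)` and `div h(n) = h(n+1) - h(n)`. -/
theorem stampach_waclawek_p_hardy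
    (p : ℝ) (hp : 1 < p) (v : ℕ → ℝ) (hv : ∀ n, 1 ≤ n → 0 ≤ v n)
    (φ : ℕ → ℝ) (hφ0 : φ 0 = 0)
    (hφ : ∀ n, 1 ≤ n → 0 < φ n ∧ φ n ≤ φ (n + 1))
    (u : ℕ → ℂ) (hu : (Function.support u).Finite) (hu0 : u 0 = 0) :
    -∑' n : ℕ,
        (v (n + 2) * (φ (n + 2) - φ (n + 1)) ^ (p - 1)
            - v (n + 1) * (φ (n + 1) - φ n) ^ (p - 1)) / φ (n + 1) ^ (p - 1)
          * ‖u (n + 1)‖ ^ p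
      ≤ ∑' n : ℕ, v (n + 1) * ‖u (n + 1) - u n‖ ^ p := by
  have hp0 : p ≠ 0 := by linarith
  obtain ⟨M, hM⟩ := hu.bddAbove
  have huN : ∀ n, M + 1 ≤ n → u n = 0 := by
    intro n hn
    by_contra hne
    have := hM (Function.mem_support.2 hne)
    omega
  rw [tsum_eq_sum (s := Finset.range (M + 1)), tsum_eq_sum (s := Finset.range (M + 1))]
  rotate_left
  · intro n hn
    have hn' : M + 1 ≤ n := by simpa using hn
    rw [huN n hn', huN (n + 1) (by omega), sub_zero, norm_zero, Real.zero_rpow hp0, mul_zero]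
  · intro n hn
    have hn' : M + 1 ≤ n := by simpa using hn
    rw [huN (n + 1) (by omega), norm_zero, Real.zero_rpow hp0, mul_zero]
  let h : ℕ → ℝ := fun n => v (n + 1) * (φ (n + 1) - φ n) ^ (p - 1)
  let F : ℕ → ℝ := fun n => ‖u n‖ ^ p / φ n ^ (p - 1)
  have hF : ∀ n, u n = 0 → F n = 0 := by
    intro n hn
    simp only [F, hn, norm_zero, Real.zero_rpow hp0, zero_div]
  have telescope := Finset.sum_range_sub (fun n => h n * F n) (M + 1)
  simp only [hF 0 hu0, hF (M + 1) (huN _ le_rfl), mul_zero, sub_zero] at telescope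
  have byParts : -∑ n ∈ Finset.range (M + 1), (h (n + 1) - h n) / φ (n + 1) ^ (p - 1)
        * ‖u (n + 1)‖ ^ p = ∑ n ∈ Finset.range (M + 1), h n * (F (n + 1) - F n) := by
    rw [neg_eq_iff_add_eq_zero, ← Finset.sum_add_distrib, ← telescope]
    refine Finset.sum_congr rfl fun n _ => ?_
    simp only [F]
    ring
  refine byParts.trans_le (Finset.sum_le_sum fun n _ => ?_)
  have hφn : 0 ≤ φ n ∧ φ n ≤ φ (n + 1) := by
    rcases n with _ | n
    · exact ⟨hφ0.ge, hφ0.trans_le (hφ 1 le_rfl).1.le⟩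
    · exact ⟨(hφ (n + 1) (by omega)).1.le, (hφ (n + 1) (by omega)).2⟩
  have hzero : φ n = 0 → ‖u n‖ = 0 := by
    intro hn
    rcases n with _ | n
    · simp [hu0]
    · exact absurd hn (hφ (n + 1) (by omega)).1.ne'
  have htri : ‖u (n + 1)‖ ≤ ‖u (n + 1) - u n‖ + ‖u n‖ := by
    simpa using norm_add_le (u (n + 1) - u n) (u n)
  have picone := rpow_sub_mul_picone_le hp (norm_nonneg (u n)) (norm_nonneg (u (n + 1)))
    (norm_nonneg (u (n + 1) - u n)) htri hφn.1 hφn.2 hzero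
  rw [mul_assoc]
  exact mul_le_mul_of_nonneg_left picone (hv (n + 1) (by omega))
end

section
/- Let v be a non-negative real-valued function on ℕ = {1,2,...} and let φ : ℕ₀ → [0,∞) satisfy φ(n) > 0 for all n ≥ 1 and φ(0) = 0. Then for every finitely supported sequence u : ℕ₀ → ℂ with u(0) = 0, one has the identity ∑_{n=1}^∞ v(n)|u(n) − u(n−1)|² + ∑_{n=1}^∞ (div(v(n)·∇φ(n)) / φ(n))·|u(n)|² = ∑_{n=1}^∞ v(n+1)·| √(φ(n)/φ(n+1))·u(n+1) − √(φ(n+1)/φ(n))·u(n) |². -/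
open Complex

/-- The square of a difference rescaled by reciprocal factors `√(a / b)` and `√(b / a)`. -/
lemma norm_sq_sqrt_div_mul_sub {a b : ℝ} (ha : 0 < a) (hb : 0 < b) (z w : ℂ) :
    ‖((Real.sqrt (a / b) : ℝ) : ℂ) * z - ((Real.sqrt (b / a) : ℝ) : ℂ) * w‖ ^ 2
      = ‖z - w‖ ^ 2 + (a - b) / b * ‖z‖ ^ 2 + (b - a) / a * ‖w‖ ^ 2 := by
  have hs : Real.sqrt (a / b) ^ 2 = a / b := Real.sq_sqrt (by positivity)
  have ht : Real.sqrt (b / a) ^ 2 = b / a := Real.sq_sqrt (by positivity)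
  have hst : Real.sqrt (a / b) * Real.sqrt (b / a) = 1 := by
    rw [← Real.sqrt_mul (by positivity), div_mul_div_cancel₀ hb.ne', div_self ha.ne',
      Real.sqrt_one]
  have hab : (a - b) / b = a / b - 1 := by field_simp
  have hba : (b - a) / a = b / a - 1 := by field_simp
  rw [hab, hba]
  simp only [Complex.sq_norm, Complex.normSq_apply, Complex.sub_re, Complex.sub_im,
    Complex.re_ofReal_mul, Complex.im_ofReal_mul]
  linear_combination (-2 * (z.re * w.re + z.im * w.im)) * hst
    + (z.re ^ 2 + z.im ^ 2) * hs + (w.re ^ 2 + w.im ^ 2) * ht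

/-- Huang–Ye identity on `ℕ`:
`∑ v(n)|u(n)-u(n-1)|² + ∑ (div(v(n)∇φ(n))/φ(n))|u(n)|²
  = ∑ v(n+1)|√(φ(n)/φ(n+1)) u(n+1) - √(φ(n+1)/φ(n)) u(n)|²`. -/
theorem huang_ye_identity
    (v : ℕ → ℝ) (hv : ∀ n, 1 ≤ n → 0 ≤ v n)
    (φ : ℕ → ℝ) (hφ0 : φ 0 = 0) (hφpos : ∀ n, 1 ≤ n → 0 < φ n)
    (u : ℕ → ℂ) (hu : (Function.support u).Finite) (hu0 : u 0 = 0) :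
    (∑' n : ℕ, v (n + 1) * ‖u (n + 1) - u n‖ ^ 2)
        + (∑' n : ℕ,
            (v (n + 2) * (φ (n + 2) - φ (n + 1)) - v (n + 1) * (φ (n + 1) - φ n))
              / φ (n + 1) * ‖u (n + 1)‖ ^ 2)
      = ∑' n : ℕ,
          v (n + 2) *
            ‖((Real.sqrt (φ (n + 1) / φ (n + 2)) : ℝ) : ℂ) * u (n + 2)
              - ((Real.sqrt (φ (n + 2) / φ (n + 1)) : ℝ) : ℂ) * u (n + 1)‖ ^ 2 := by
  obtain ⟨N, hN⟩ := hu.bddAbove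
  have hzero : ∀ n, N < n → u n = 0 := fun n hn => by
    by_contra h
    exact absurd (hN (Function.mem_support.mpr h)) (by omega)
  have hout : ∀ n, n ∉ Finset.range (N + 1) → u n = 0 ∧ u (n + 1) = 0 ∧ u (n + 2) = 0 := by
    intro n hn
    rw [Finset.mem_range] at hn
    exact ⟨hzero _ (by omega), hzero _ (by omega), hzero _ (by omega)⟩
  rw [tsum_eq_sum (s := Finset.range (N + 1)) (fun n hn => by simp [hout n hn]),
    tsum_eq_sum (s := Finset.range (N + 1)) (fun n hn => by simp [hout n hn]),
    tsum_eq_sum (s := Finset.range (N + 1)) (fun n hn => by simp [hout n hn]),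
    ← sub_eq_zero, ← Finset.sum_add_distrib, ← Finset.sum_sub_distrib]
  -- The difference of the summands telescopes along `G`, which vanishes at both ends.
  let G : ℕ → ℝ := fun n => v (n + 1) * ‖u (n + 1) - u n‖ ^ 2
    - v (n + 1) * (φ (n + 1) - φ n) / φ (n + 1) * ‖u (n + 1)‖ ^ 2
  have hG0 : G 0 = 0 := by
    have := (hφpos 1 le_rfl).ne'
    simp [G, hφ0, hu0, this]
  have hGN : G (N + 1) = 0 := by
    simp [G, hzero (N + 1) (by omega), hzero (N + 1 + 1) (by omega)]
  rw [Finset.sum_congr rfl (g := fun n => G n - G (n + 1)), Finset.sum_range_sub', hG0, hGN,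
    sub_zero]
  intro n _
  have h₁ := hφpos (n + 1) (by omega)
  have h₂ := hφpos (n + 2) (by omega)
  rw [norm_sq_sqrt_div_mul_sub h₁ h₂]
  simp only [G, add_assoc, Nat.reduceAdd]
  ring
end

section
/- Let 1 < p < ∞. Then for every finitely supported sequence u : ℕ₀ → ℂ with u(0) = 0, one has the identity ∑_{n=1}^∞ |u(n) − u(n−1)|^p = ∑_{n=1}^∞ w_p(n) |u(n)|^p + ∑_{n=2}^∞ R_p(u(n), n^{(p−1)/p}), where w_p(n) := (1 − (1 − 1/n)^{(p−1)/p})^{p−1} − ((1 + 1/n)^{(p−1)/p} − 1)^{p−1}. -/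
open Complex

/-- The optimal Fischer–Keller–Pogorzelski Hardy weight
`w_p(n) = (1 - (1-1/n)^{(p-1)/p})^{p-1} - ((1+1/n)^{(p-1)/p} - 1)^{p-1}`. -/
noncomputable def wFKP (p : ℝ) (n : ℕ) : ℝ :=
  (1 - (1 - 1 / (n : ℝ)) ^ ((p - 1) / p)) ^ (p - 1)
    - ((1 + 1 / (n : ℝ)) ^ ((p - 1) / p) - 1) ^ (p - 1)

/-- The first-order terms of the two `C_p`-functionals in `R_p` cancel. -/
lemma Rp_eq (p : ℝ) (φ : ℕ → ℝ) (u : ℕ → ℂ) (n : ℕ)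
    (ha : 0 < φ (n - 1)) (hab : φ (n - 1) < φ n) :
    Rp p φ u n = ‖u n - u (n - 1)‖ ^ p - (1 - φ (n - 1) / φ n) ^ (p - 1) * ‖u n‖ ^ p
      + (φ n / φ (n - 1) - 1) ^ (p - 1) * ‖u (n - 1)‖ ^ p := by
  unfold Rp Cp
  generalize φ (n - 1) = a at *
  generalize φ n = b at *
  generalize u (n - 1) = V
  generalize u n = U
  have hb : 0 < b := ha.trans hab
  have hd : 0 < b - a := sub_pos.2 hab
  have hbC : (b : ℂ) ≠ 0 := by exact_mod_cast hb.ne'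
  have hdb : 0 < (b - a) / b := div_pos hd hb
  have e1 : U - V - (((a / b : ℝ) : ℂ) * U - V) = (((b - a) / b : ℝ) : ℂ) * U := by
    push_cast; field_simp; ring
  have e2 : V / (a : ℂ) - (V / (a : ℂ) - U / (b : ℂ)) = ((1 / b : ℝ) : ℂ) * U := by
    push_cast; field_simp; ring
  have e3 : V / (a : ℂ) - U / (b : ℂ) = ((1 / a : ℝ) : ℂ) * V - ((1 / b : ℝ) : ℂ) * U := by
    push_cast; ring
  have e4 : V / (a : ℂ) = ((1 / a : ℝ) : ℂ) * V := by push_cast; ring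
  have e5 : 1 - a / b = (b - a) / b := by field_simp
  have e6 : b / a - 1 = (b - a) / a := by field_simp
  rw [e1, e2, e3, e4, e5, e6]
  have hnorm (r : ℝ) (hr : 0 < r) (z : ℂ) (q : ℝ) : ‖(r : ℂ) * z‖ ^ q = r ^ q * ‖z‖ ^ q := by
    rw [norm_mul, Complex.norm_real, Real.norm_of_nonneg hr.le,
      Real.mul_rpow hr.le (norm_nonneg z)]
  have hsub (r : ℝ) (hr : 0 < r) : r ^ (p - 1) = r ^ (p - 2) * r := by
    rw [← Real.rpow_add_one hr.ne']; ring_nf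
  have hpow (r : ℝ) (hr : 0 < r) : r ^ p = r ^ (p - 2) * r * r := by
    rw [← hsub r hr, ← Real.rpow_add_one hr.ne']; ring_nf
  rw [hnorm _ hdb, hnorm _ hdb, hnorm _ (one_div_pos.2 hb), hnorm _ (one_div_pos.2 hb),
    hnorm _ (one_div_pos.2 ha), Real.div_rpow hd.le hb.le, Real.div_rpow hd.le hb.le,
    Real.div_rpow hd.le hb.le, Real.div_rpow hd.le ha.le, Real.div_rpow one_pos.le hb.le,
    Real.div_rpow one_pos.le hb.le, Real.div_rpow one_pos.le ha.le, Real.one_rpow, Real.one_rpow,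
    hsub _ hd, hsub _ hb, hsub _ ha, hpow _ hd, hpow _ hb, hpow _ ha]
  have hy := Real.rpow_pos_of_pos hb (p - 2)
  have hz := Real.rpow_pos_of_pos ha (p - 2)
  generalize b ^ (p - 2) = y at *
  generalize a ^ (p - 2) = z at *
  generalize (b - a) ^ (p - 2) = x at *
  generalize ‖U - V‖ ^ p = N₀
  generalize ‖U‖ ^ p = N₁
  generalize ‖V‖ ^ p = N₂
  generalize ‖U‖ ^ (p - 2) = N₃
  simp only [map_sub, map_mul, Complex.conj_ofReal, Complex.mul_re, Complex.mul_im,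
    Complex.sub_re, Complex.sub_im, Complex.conj_re, Complex.conj_im, Complex.ofReal_re,
    Complex.ofReal_im]
  field_simp
  ring

/-- Sharp remainder form of the Fischer–Keller–Pogorzelski inequality. -/
theorem fkp_identity
    (p : ℝ) (hp : 1 < p)
    (u : ℕ → ℂ) (hu : (Function.support u).Finite) (hu0 : u 0 = 0) :
    ∑' n : ℕ, ‖u (n + 1) - u n‖ ^ p
      = (∑' n : ℕ, wFKP p (n + 1) * ‖u (n + 1)‖ ^ p)
          + (∑' n : ℕ, Rp p (fun k => (k : ℝ) ^ ((p - 1) / p)) u (n + 2)) := by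
  have hp0 : 0 < p := one_pos.trans hp
  have hs : 0 < (p - 1) / p := div_pos (sub_pos.2 hp) hp0
  set s := (p - 1) / p with hs_def
  obtain ⟨N, hN⟩ : ∃ N, ∀ n, N ≤ n → u n = 0 := by
    obtain ⟨M, hM⟩ := hu.bddAbove
    refine ⟨M + 1, fun n hn => ?_⟩
    by_contra h
    have := hM (Function.mem_support.2 h)
    omega
  have summable_of_tail (f : ℕ → ℝ) (hf : ∀ n, N ≤ n → f n = 0) : Summable f :=
    summable_of_ne_finset_zero (s := Finset.range N) fun n hn => hf n (by simpa using hn)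
  set A : ℕ → ℝ := fun n => (1 - (1 - 1 / (n : ℝ)) ^ s) ^ (p - 1) * ‖u n‖ ^ p with hA
  set B : ℕ → ℝ := fun n => ((1 + 1 / (n : ℝ)) ^ s - 1) ^ (p - 1) * ‖u n‖ ^ p with hB
  set D : ℕ → ℝ := fun n => ‖u (n + 1) - u n‖ ^ p with hD
  have hA0 (n : ℕ) (hn : N ≤ n) : A n = 0 := by simp [hA, hN n hn, hp0.ne']
  have hB0 (n : ℕ) (hn : N ≤ n) : B n = 0 := by simp [hB, hN n hn, hp0.ne']
  have hDs : Summable D := summable_of_tail _ fun n hn => by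
    simp [hD, hN n hn, hN (n + 1) (by omega), hp0.ne']
  have hAs : Summable fun n => A (n + 1) := summable_of_tail _ fun n hn => hA0 _ (by omega)
  have hBs : Summable fun n => B (n + 1) := summable_of_tail _ fun n hn => hB0 _ (by omega)
  have hw (n : ℕ) : wFKP p (n + 1) * ‖u (n + 1)‖ ^ p = A (n + 1) - B (n + 1) := by
    simp only [wFKP, hA, hB, sub_mul, hs_def]
  have hR (n : ℕ) : Rp p (fun k => (k : ℝ) ^ s) u (n + 2)
      = D (n + 1) - A (n + 1 + 1) + B (n + 1) := by
    rw [Rp_eq p]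
    · simp only [hA, hB, hD, show n + 2 - 1 = n + 1 from rfl]
      rw [← Real.div_rpow (by positivity) (by positivity),
        ← Real.div_rpow (by positivity) (by positivity)]
      have h1 : ((n + 1 : ℕ) : ℝ) / ((n + 2 : ℕ) : ℝ) = 1 - 1 / ((n + 1 + 1 : ℕ) : ℝ) := by
        push_cast; field_simp; ring
      have h2 : ((n + 2 : ℕ) : ℝ) / ((n + 1 : ℕ) : ℝ) = 1 + 1 / ((n + 1 : ℕ) : ℝ) := by
        push_cast; field_simp; ring
      rw [h1, h2]
    · simp only [show n + 2 - 1 = n + 1 from rfl]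
      positivity
    · simp only [show n + 2 - 1 = n + 1 from rfl]
      exact Real.rpow_lt_rpow (by positivity) (by push_cast; linarith) hs
  have hDA : D 0 = A 1 := by simp [hD, hA, hu0, hs.ne']
  have hDs' : Summable fun n => D (n + 1) := (summable_nat_add_iff 1).2 hDs
  have hAs' : Summable fun n => A (n + 1 + 1) :=
    (summable_nat_add_iff (f := fun n => A (n + 1)) 1).2 hAs
  simp_rw [hw, hR]
  rw [hAs.tsum_sub hBs, (hDs'.sub hAs').tsum_add hBs, hDs'.tsum_sub hAs',
    hDs.tsum_eq_zero_add, hAs.tsum_eq_zero_add, hDA]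
  ring
end

section
/- For every finitely supported sequence u : ℕ₀ → ℂ with u(0) = 0, one has the identity ∑_{n=1}^∞ |u(n) − u(n−1)|² = ∑_{n=1}^∞ w_2(n) |u(n)|² + ∑_{n=2}^∞ | ((n−1)/n)^{1/4}·u(n) − (n/(n−1))^{1/4}·u(n−1) |², where w_2(n) := 2 − ((1 + 1/n)^{1/2} + (1 − 1/n)^{1/2}). -/
open Complex

/-- Weighting `x` and `y` by mutually inverse real factors preserves the cross term of
`‖x - y‖ ^ 2`. -/
lemma norm_sub_sq_eq_of_mul_eq_one {a b : ℝ} (hab : a * b = 1) (x y : ℂ) :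
    ‖x - y‖ ^ 2 = ‖(a : ℂ) * x - (b : ℂ) * y‖ ^ 2
      + (1 - a ^ 2) * ‖x‖ ^ 2 + (1 - b ^ 2) * ‖y‖ ^ 2 := by
  simp only [Complex.sq_norm, Complex.normSq_apply, Complex.sub_re, Complex.sub_im,
    Complex.re_ofReal_mul, Complex.im_ofReal_mul]
  linear_combination (2 * x.re * y.re + 2 * x.im * y.im) * hab

lemma rpow_quarter_sq {x : ℝ} (hx : 0 ≤ x) : (x ^ ((1 : ℝ) / 4)) ^ 2 = √x := by
  rw [← Real.rpow_natCast, ← Real.rpow_mul hx, Real.sqrt_eq_rpow]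
  norm_num

lemma rpow_div_mul_rpow_div_swap {x y : ℝ} (hx : 0 < x) (hy : 0 < y) (s : ℝ) :
    (x / y) ^ s * (y / x) ^ s = 1 := by
  rw [← Real.mul_rpow (by positivity) (by positivity), div_mul_div_cancel₀ hy.ne',
    div_self hx.ne', Real.one_rpow]

/-- The truncated identity, with its boundary term. -/
lemma sum_range_norm_sub_sq (u : ℕ → ℂ) (hu0 : u 0 = 0) (N : ℕ) :
    ∑ n ∈ Finset.range (N + 1), ‖u (n + 1) - u n‖ ^ 2
      = (∑ n ∈ Finset.range (N + 1),
          (2 - (Real.sqrt (1 + 1 / ((n : ℝ) + 1)) + Real.sqrt (1 - 1 / ((n : ℝ) + 1))))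
            * ‖u (n + 1)‖ ^ 2)
        + (∑ n ∈ Finset.range N,
            ‖(((((n : ℝ) + 1) / ((n : ℝ) + 2)) ^ ((1 : ℝ) / 4) : ℝ) : ℂ) * u (n + 2)
              - (((((n : ℝ) + 2) / ((n : ℝ) + 1)) ^ ((1 : ℝ) / 4) : ℝ) : ℂ) * u (n + 1)‖ ^ 2)
        + (Real.sqrt (1 + 1 / ((N : ℝ) + 1)) - 1) * ‖u (N + 1)‖ ^ 2 := by
  induction N with
  | zero =>
    simp [hu0]
    ring
  | succ N ih =>
    have step := norm_sub_sq_eq_of_mul_eq_one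
      (rpow_div_mul_rpow_div_swap (x := (N : ℝ) + 1) (y := (N : ℝ) + 2)
        (by positivity) (by positivity) (1 / 4)) (u (N + 2)) (u (N + 1))
    rw [rpow_quarter_sq (by positivity), rpow_quarter_sq (by positivity)] at step
    have h_left : 1 - 1 / (((N + 1 : ℕ) : ℝ) + 1) = ((N : ℝ) + 1) / ((N : ℝ) + 2) := by
      push_cast
      field_simp
      ring
    have h_right : 1 + 1 / ((N : ℝ) + 1) = ((N : ℝ) + 2) / ((N : ℝ) + 1) := by
      field_simp
      ring
    rw [h_right] at ih
    rw [Finset.sum_range_succ, Finset.sum_range_succ _ (N + 1), ih, step,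
      Finset.sum_range_succ _ N, Finset.sum_range_succ _ N, h_left]
    ring

/-- Krejčiřík–Štampach sharp form of the Keller–Pinchover–Pogorzelski inequality:
`∑ |u(n)-u(n-1)|² = ∑ w₂(n)|u(n)|² + ∑_{n≥2} |((n-1)/n)^{1/4} u(n) - (n/(n-1))^{1/4} u(n-1)|²`,
where `w₂(n) = 2 - ((1+1/n)^{1/2} + (1-1/n)^{1/2})`. -/
theorem krejcirik_stampach_identity
    (u : ℕ → ℂ) (hu : (Function.support u).Finite) (hu0 : u 0 = 0) :
    ∑' n : ℕ, ‖u (n + 1) - u n‖ ^ 2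
      = (∑' n : ℕ,
          (2 - (Real.sqrt (1 + 1 / ((n : ℝ) + 1)) + Real.sqrt (1 - 1 / ((n : ℝ) + 1))))
            * ‖u (n + 1)‖ ^ 2)
        + (∑' n : ℕ,
            ‖(((((n : ℝ) + 1) / ((n : ℝ) + 2)) ^ ((1 : ℝ) / 4) : ℝ) : ℂ) * u (n + 2)
              - (((((n : ℝ) + 2) / ((n : ℝ) + 1)) ^ ((1 : ℝ) / 4) : ℝ) : ℂ) * u (n + 1)‖ ^ 2) := by
  obtain ⟨N, hN⟩ : ∃ N, ∀ n, N < n → u n = 0 := by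
    obtain ⟨N, hN⟩ := hu.bddAbove
    refine ⟨N, fun n hn => ?_⟩
    by_contra h
    exact absurd (hN h) (by omega)
  rw [tsum_eq_sum (s := Finset.range (N + 1)), tsum_eq_sum (s := Finset.range (N + 1)),
    tsum_eq_sum (s := Finset.range N), sum_range_norm_sub_sq u hu0 N, hN (N + 1) (by omega)]
  · simp
  · intro n hn
    rw [Finset.mem_range] at hn
    simp [hN (n + 2) (by omega), hN (n + 1) (by omega)]
  · intro n hn
    rw [Finset.mem_range] at hn
    simp [hN (n + 1) (by omega)]
  · intro n hn
    rw [Finset.mem_range] at hn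
    simp [hN (n + 1) (by omega), hN n (by omega)]
end

section
/- Let 1 < p < ∞. For every a ∈ ℂ and every t ∈ [0,1], one has the identity |a − t|^p − (1 − t)^{p−1}·(|a|^p − t) = C_p(a − t, t·(a − 1)) + t·(1 − t)^{p−1}·C_p(1, 1 − a). -/
open Complex

/-- The sharp `C_p` algebraic identity: for `a ∈ ℂ` and `t ∈ [0,1]`,
`|a-t|^p - (1-t)^{p-1}(|a|^p - t) = C_p(a-t, t(a-1)) + t(1-t)^{p-1} C_p(1, 1-a)`. -/
theorem cp_algebraic_identity
    (p : ℝ) (hp : 1 < p) (a : ℂ) (t : ℝ) (ht : t ∈ Set.Icc (0 : ℝ) 1) :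
    ‖a - (t : ℂ)‖ ^ p - (1 - t) ^ (p - 1) * (‖a‖ ^ p - t)
      = Cp p (a - (t : ℂ)) ((t : ℂ) * (a - 1)) + t * (1 - t) ^ (p - 1) * Cp p 1 (1 - a) := by
  have hs : 0 ≤ 1 - t := sub_nonneg.mpr ht.2
  have hdiff : a - (t : ℂ) - (t : ℂ) * (a - 1) = ((1 - t : ℝ) : ℂ) * a := by
    push_cast; ring
  have hnorm : ‖((1 - t : ℝ) : ℂ) * a‖ = (1 - t) * ‖a‖ := by
    rw [norm_mul, Complex.norm_of_nonneg hs]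
  have hpow : (1 - t) ^ p = (1 - t) ^ (p - 1) * (1 - t) := by
    rw [← Real.rpow_add_one' hs (by linarith), sub_add_cancel]
  have hpow' : (1 - t) ^ (p - 1) = (1 - t) ^ (p - 2) * (1 - t) := by
    rw [← Real.rpow_add_one' hs (by linarith)]
    ring_nf
  have hre : (((1 - t : ℝ) : ℂ) * a * (starRingEnd ℂ) ((t : ℂ) * (a - 1))).re
      = -((1 - t) * t * (a * (starRingEnd ℂ) (1 - a)).re) := by
    simp only [map_mul, map_sub, map_one, conj_ofReal, mul_re, mul_im, sub_re, sub_im,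
      ofReal_re, ofReal_im, one_re, one_im, conj_re, conj_im]
    ring
  unfold Cp
  rw [hdiff, hnorm, hre, sub_sub_cancel, norm_one, Real.one_rpow,
    Real.mul_rpow hs (norm_nonneg a), Real.mul_rpow hs (norm_nonneg a), hpow, hpow']
  ring
end

section
/- Let 1 < p < ∞. For every finitely supported sequence v : ℕ₀ → ℝ, one has ∑_{n=2}^∞ |v(n) − v(n−1)|^p · n^{p−1} ≥ ((p−1)/p)^p · inf_{c ∈ ℝ} ∑_{n=2}^∞ |v(n) − c|^p / (n·(log n)^p). -/
/-- Young's inequality in the form `p b a^(p-1) ≤ b^p + (p-1) a^p`. -/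
theorem young_mul_rpow_sub_one {p : ℝ} (hp : 1 < p) {a b : ℝ} (ha : 0 ≤ a) (hb : 0 ≤ b) :
    p * (b * a ^ (p - 1)) ≤ b ^ p + (p - 1) * a ^ p := by
  have hp0 : 0 < p := by linarith
  have hp1 : p - 1 ≠ 0 := by linarith
  have h := Real.young_inequality_of_nonneg hb (Real.rpow_nonneg ha (p - 1))
    (Real.HolderConjugate.conjExponent hp)
  have hpow : (a ^ (p - 1)) ^ p.conjExponent = a ^ p := by
    rw [← Real.rpow_mul ha, Real.conjExponent, mul_div_cancel₀ _ hp1]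
  rw [hpow, Real.conjExponent] at h
  calc p * (b * a ^ (p - 1)) ≤ p * (b ^ p / p + a ^ p / (p / (p - 1))) := by gcongr
    _ = b ^ p + (p - 1) * a ^ p := by field_simp

/-- The one-step estimate in Elliott's proof of the weighted Hardy inequality. -/
theorem weighted_hardy_step {p : ℝ} (hp : 1 < p) {l L M A B a : ℝ}
    (hl : 0 ≤ l) (hM : 0 ≤ M) (hA : 0 ≤ A) (hB : 0 ≤ B) (ha : 0 ≤ a)
    (hlL : l ≤ L - M) (h : L * A - M * B ≤ l * a) :
    l * A ^ p + p / (p - 1) * (L * A ^ p - M * B ^ p) ≤ (p / (p - 1)) ^ p * (l * a ^ p) := by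
  have hp1 : 0 < p - 1 := by linarith
  have hq : 0 ≤ p / (p - 1) := by positivity
  have hX : 0 ≤ A ^ (p - 1) := Real.rpow_nonneg hA _
  have hAX : A ^ p = A * A ^ (p - 1) := by
    rw [← Real.rpow_one_add' hA (by linarith)]
    congr 1
    ring
  have hBA := mul_le_mul_of_nonneg_left (young_mul_rpow_sub_one hp hA hB)
    (mul_nonneg hM hq)
  have haA := mul_le_mul_of_nonneg_left
    (young_mul_rpow_sub_one hp hA (mul_nonneg hq ha)) hl
  rw [Real.mul_rpow hq ha] at haA
  have hstep := mul_le_mul_of_nonneg_left (mul_le_mul_of_nonneg_right h hX)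
    (mul_nonneg (by linarith : 0 ≤ p) hq)
  have hgap := mul_le_mul_of_nonneg_right hlL (mul_nonneg (by linarith : 0 ≤ p)
    (Real.rpow_nonneg hA p))
  have hqp : p / (p - 1) * (p - 1) = p := div_mul_cancel₀ _ hp1.ne'
  generalize p / (p - 1) = q at *
  generalize q ^ p = Q at *
  generalize A ^ (p - 1) = X at *
  rw [hAX] at haA hBA hgap ⊢
  generalize B ^ p = Y at *
  generalize a ^ p = Z at *
  have hqp' : q * p = p + q := by linarith
  linear_combination haA + hstep + hBA + hgap + (M * A * X - L * A * X) * hqp'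

/-- Partial sums of the critical Hardy inequality, with the boundary term that drives the
induction. -/
theorem critical_hardy_partial_sum {p : ℝ} (hp : 1 < p) (v : ℕ → ℝ) (N : ℕ) :
    ∑ n ∈ Finset.range N,
        |v (n + 2) - v 1| ^ p / (((n : ℝ) + 2) * Real.log ((n : ℝ) + 2) ^ p)
      + p / (p - 1) *
        (Real.log ((N : ℝ) + 1) * (|v (N + 1) - v 1| / Real.log ((N : ℝ) + 1)) ^ p)
      ≤ (p / (p - 1)) ^ p *
        ∑ n ∈ Finset.range N, |v (n + 2) - v (n + 1)| ^ p * ((n : ℝ) + 2) ^ (p - 1) := by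
  induction N with
  | zero => simp
  | succ N ih =>
    have hN : (0 : ℝ) ≤ N := N.cast_nonneg
    have hN2 : (0 : ℝ) < (N : ℝ) + 2 := by linarith
    have hL : 0 < Real.log ((N : ℝ) + 2) := Real.log_pos (by linarith)
    have hM : 0 ≤ Real.log ((N : ℝ) + 1) := Real.log_nonneg (by linarith)
    have hgap : ((N : ℝ) + 2)⁻¹ ≤ Real.log ((N : ℝ) + 2) - Real.log ((N : ℝ) + 1) := by
      have h := Real.one_sub_inv_le_log_of_pos
        (show 0 < ((N : ℝ) + 2) / ((N : ℝ) + 1) by positivity)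
      rw [Real.log_div (by positivity) (by positivity)] at h
      refine le_trans (le_of_eq ?_) h
      field_simp
      ring
    have hMB : Real.log ((N : ℝ) + 1) * (|v (N + 1) - v 1| / Real.log ((N : ℝ) + 1))
        = |v (N + 1) - v 1| := by
      rcases Nat.eq_zero_or_pos N with rfl | hpos
      · simp
      · have hpos' : (0 : ℝ) < N := Nat.cast_pos.mpr hpos
        exact mul_div_cancel₀ _ (Real.log_pos (by linarith)).ne'
    have hdiff : Real.log ((N : ℝ) + 2) * (|v (N + 2) - v 1| / Real.log ((N : ℝ) + 2))
        - Real.log ((N : ℝ) + 1) * (|v (N + 1) - v 1| / Real.log ((N : ℝ) + 1))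
        ≤ ((N : ℝ) + 2)⁻¹ * (((N : ℝ) + 2) * |v (N + 2) - v (N + 1)|) := by
      rw [hMB, mul_div_cancel₀ _ hL.ne', inv_mul_cancel_left₀ hN2.ne']
      simpa using abs_sub_abs_le_abs_sub (v (N + 2) - v 1) (v (N + 1) - v 1)
    have hstep := weighted_hardy_step hp (by positivity) hM (by positivity) (by positivity)
      (by positivity) hgap hdiff
    have hleft : ((N : ℝ) + 2)⁻¹ * (|v (N + 2) - v 1| / Real.log ((N : ℝ) + 2)) ^ p
        = |v (N + 2) - v 1| ^ p / (((N : ℝ) + 2) * Real.log ((N : ℝ) + 2) ^ p) := by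
      rw [Real.div_rpow (abs_nonneg _) hL.le]
      field_simp
    have hright : ((N : ℝ) + 2)⁻¹ * (((N : ℝ) + 2) * |v (N + 2) - v (N + 1)|) ^ p
        = |v (N + 2) - v (N + 1)| ^ p * ((N : ℝ) + 2) ^ (p - 1) := by
      rw [Real.mul_rpow hN2.le (abs_nonneg _), Real.rpow_sub_one hN2.ne']
      ring
    rw [hleft, hright] at hstep
    have hcast : ((N + 1 : ℕ) : ℝ) + 1 = (N : ℝ) + 2 := by push_cast; ring
    rw [Finset.sum_range_succ, Finset.sum_range_succ, hcast]
    linarith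

/-- Discrete critical Hardy inequality:
`∑_{n≥2} |v(n)-v(n-1)|^p n^{p-1} ≥ ((p-1)/p)^p inf_c ∑_{n≥2} |v(n)-c|^p/(n log^p n)`. -/
theorem discrete_critical_hardy
    (p : ℝ) (hp : 1 < p)
    (v : ℕ → ℝ) (hv : (Function.support v).Finite) :
    ((p - 1) / p) ^ p *
        ⨅ c : ℝ, ∑' n : ℕ,
          |v (n + 2) - c| ^ p / (((n : ℝ) + 2) * Real.log ((n : ℝ) + 2) ^ p)
      ≤ ∑' n : ℕ, |v (n + 2) - v (n + 1)| ^ p * ((n : ℝ) + 2) ^ (p - 1) := by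
  have hp1 : 0 < p - 1 := by linarith
  have hterm : ∀ (c : ℝ) (n : ℕ),
      0 ≤ |v (n + 2) - c| ^ p / (((n : ℝ) + 2) * Real.log ((n : ℝ) + 2) ^ p) := fun c n => by
    have hlog : 0 ≤ Real.log ((n : ℝ) + 2) :=
      Real.log_nonneg (by linarith [n.cast_nonneg (α := ℝ)])
    positivity
  have hsum : Summable fun n : ℕ =>
      |v (n + 2) - v (n + 1)| ^ p * ((n : ℝ) + 2) ^ (p - 1) := by
    obtain ⟨K, hK⟩ := hv.bddAbove
    have hzero : ∀ m, K < m → v m = 0 := fun m hm => by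
      by_contra hne
      exact absurd (hK hne) (not_le.mpr hm)
    refine summable_of_ne_finset_zero (s := Finset.range K) fun n hn => ?_
    rw [Finset.mem_range, not_lt] at hn
    rw [hzero (n + 2) (by omega), hzero (n + 1) (by omega)]
    simp [Real.zero_rpow (by linarith : p ≠ 0)]
  have hpartial : ∑' n : ℕ,
      |v (n + 2) - v 1| ^ p / (((n : ℝ) + 2) * Real.log ((n : ℝ) + 2) ^ p)
      ≤ (p / (p - 1)) ^ p *
        ∑' n : ℕ, |v (n + 2) - v (n + 1)| ^ p * ((n : ℝ) + 2) ^ (p - 1) := by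
    refine Real.tsum_le_of_sum_range_le (hterm (v 1)) fun N => ?_
    have hlog : 0 ≤ Real.log ((N : ℝ) + 1) :=
      Real.log_nonneg (by linarith [N.cast_nonneg (α := ℝ)])
    refine (le_add_of_nonneg_right (by positivity)).trans
      ((critical_hardy_partial_sum hp v N).trans ?_)
    gcongr
    exact hsum.sum_le_tsum _ fun n _ => by positivity
  have hinf := ciInf_le (f := fun c : ℝ => ∑' n : ℕ,
      |v (n + 2) - c| ^ p / (((n : ℝ) + 2) * Real.log ((n : ℝ) + 2) ^ p))
    ⟨0, by rintro _ ⟨c, rfl⟩; exact tsum_nonneg (hterm c)⟩ (v 1)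
  refine (mul_le_mul_of_nonneg_left (hinf.trans hpartial) (by positivity)).trans (le_of_eq ?_)
  rw [← mul_assoc, ← Real.mul_rpow (by positivity) (by positivity),
    div_mul_div_cancel₀ (by linarith : p ≠ 0), div_self hp1.ne', Real.one_rpow, one_mul]
end

section
/- Let 1 < p < ∞. For every finitely supported sequence v : ℕ₀ → ℝ, one has ∑_{m=2}^∞ |v(m) − v(1)|^p / (m·(log m)^p) ≤ (p/(p−1))^p · ∑_{m=2}^∞ |v(m) − v(m−1)|^p · m^{p−1}. -/
/-- Young's inequality in the form `p * (y ^ (p - 1) * x) ≤ x ^ p + (p - 1) * y ^ p`. -/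
lemma young_rpow_sub_one {p x y : ℝ} (hp : 1 < p) (hx : 0 ≤ x) (hy : 0 ≤ y) :
    p * (y ^ (p - 1) * x) ≤ x ^ p + (p - 1) * y ^ p := by
  have hpq := Real.HolderConjugate.conjExponent hp
  have h := Real.young_inequality_of_nonneg (Real.rpow_nonneg hy (p - 1)) hx hpq.symm
  have hp0 : p - 1 ≠ 0 := by linarith
  rw [← Real.rpow_mul hy, Real.conjExponent, mul_div_cancel₀ _ hp0] at h
  calc p * (y ^ (p - 1) * x) ≤ p * (y ^ p / (p / (p - 1)) + x ^ p / p) := by gcongr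
    _ = x ^ p + (p - 1) * y ^ p := by field_simp; ring

/-- The pointwise estimate behind the weighted Hardy inequality: `x` and `y` are consecutive
weighted means, with total weights `L` and `L + l`, and `a` is the new entry. -/
lemma hardy_step {p L l x y a : ℝ} (hp : 1 < p) (hL : 0 ≤ L) (hl : 0 ≤ l)
    (hx : 0 ≤ x) (hy : 0 ≤ y) (ha : 0 ≤ a) (h : (L + l) * y ≤ L * x + l * a) :
    l * y ^ p ≤ l * (p / (p - 1) * a) ^ p
      + p / (p - 1) * (L * x ^ p - (L + l) * y ^ p) := by
  have hp1 : 0 < p - 1 := by linarith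
  have hq : 0 < p / (p - 1) := by positivity
  have young_x := mul_le_mul_of_nonneg_left (young_rpow_sub_one hp hx hy) hL
  have young_a := mul_le_mul_of_nonneg_left
    (young_rpow_sub_one hp (mul_nonneg hq.le ha) hy) hl
  have hy_pow : y ^ (p - 1) * y = y ^ p := by
    rw [← Real.rpow_add_one' hy (by linarith), sub_add_cancel]
  have hmean := mul_le_mul_of_nonneg_left h (Real.rpow_nonneg hy (p - 1))
  have hmean' : (L + l) * y ^ p ≤ L * (y ^ (p - 1) * x) + l * (y ^ (p - 1) * a) := by
    rw [← hy_pow]; linarith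
  set q := p / (p - 1) with hq_def
  have hpq : q * (p - 1) = p := by rw [hq_def]; field_simp
  have scaled_mean := mul_le_mul_of_nonneg_left hmean' (mul_nonneg (by linarith : 0 ≤ p) hq.le)
  have scaled_young := mul_le_mul_of_nonneg_left young_x hq.le
  have expand_x : q * (L * (x ^ p + (p - 1) * y ^ p)) = q * L * x ^ p + p * L * y ^ p := by
    linear_combination L * y ^ p * hpq
  have expand_y : p * q * ((L + l) * y ^ p) = (L + l) * y ^ p * (p + q) := by
    linear_combination (L + l) * y ^ p * hpq
  linarith

/-- The estimate `hardy_step` with the logarithmic weights `log (m + 2) - log (m + 1)`. -/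
lemma log_hardy_step {p u w d : ℝ} (hp : 1 < p) (m : ℕ) (hu : 0 ≤ u) (hw : 0 ≤ w)
    (hd : 0 ≤ d) (hu0 : m = 0 → u = 0) (h : w ≤ u + d) :
    w ^ p / (((m : ℝ) + 2) * Real.log ((m : ℝ) + 2) ^ p)
      ≤ (p / (p - 1)) ^ p * (d ^ p * ((m : ℝ) + 2) ^ (p - 1))
        + p / (p - 1) * (Real.log ((m : ℝ) + 1) * (u / Real.log ((m : ℝ) + 1)) ^ p
          - Real.log ((m : ℝ) + 2) * (w / Real.log ((m : ℝ) + 2)) ^ p) := by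
  have hm : (0 : ℝ) ≤ m := m.cast_nonneg
  have hp1 : 0 < p - 1 := by linarith
  have hL : 0 ≤ Real.log ((m : ℝ) + 1) := Real.log_nonneg (by linarith)
  have hL2 : 0 < Real.log ((m : ℝ) + 2) := Real.log_pos (by linarith)
  have hl : 1 / ((m : ℝ) + 2) ≤ Real.log ((m : ℝ) + 2) - Real.log ((m : ℝ) + 1) := by
    rw [← Real.log_div (by positivity) (by positivity)]
    refine le_trans (le_of_eq ?_) (Real.one_sub_inv_le_log_of_pos (by positivity))
    field_simp
    ring
  set l := Real.log ((m : ℝ) + 2) - Real.log ((m : ℝ) + 1) with hl_def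
  have hl0 : 0 < l := lt_of_lt_of_le (by positivity) hl
  have hsum : Real.log ((m : ℝ) + 1) + l = Real.log ((m : ℝ) + 2) := by rw [hl_def]; ring
  have hmean_u : Real.log ((m : ℝ) + 1) * (u / Real.log ((m : ℝ) + 1)) = u := by
    rcases Nat.eq_zero_or_pos m with h0 | h0
    · simp [hu0 h0]
    · have : 0 < Real.log ((m : ℝ) + 1) := Real.log_pos (by simpa using h0)
      field_simp
  have step := hardy_step (a := d / l) hp hL hl0.le (div_nonneg hu hL) (div_nonneg hw hL2.le)
    (div_nonneg hd hl0.le) (by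
      rw [hsum, hmean_u, mul_div_cancel₀ _ hL2.ne', mul_div_cancel₀ _ hl0.ne']; exact h)
  rw [hsum] at step
  have hleft : w ^ p / (((m : ℝ) + 2) * Real.log ((m : ℝ) + 2) ^ p)
      ≤ l * (w / Real.log ((m : ℝ) + 2)) ^ p := by
    calc w ^ p / (((m : ℝ) + 2) * Real.log ((m : ℝ) + 2) ^ p)
        = 1 / ((m : ℝ) + 2) * (w / Real.log ((m : ℝ) + 2)) ^ p := by
          rw [Real.div_rpow hw hL2.le]; field_simp
      _ ≤ _ := by gcongr
  have hright : l * (p / (p - 1) * (d / l)) ^ p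
      ≤ (p / (p - 1)) ^ p * (d ^ p * ((m : ℝ) + 2) ^ (p - 1)) := by
    have hinv : l⁻¹ ≤ (m : ℝ) + 2 := by
      rw [one_div] at hl
      exact inv_le_of_inv_le₀ (by positivity) hl
    have hpow : l⁻¹ ^ p = l⁻¹ ^ (p - 1) * l⁻¹ := by
      rw [← Real.rpow_add_one' (by positivity) (by linarith), sub_add_cancel]
    calc l * (p / (p - 1) * (d / l)) ^ p
        = (p / (p - 1)) ^ p * (d ^ p * l⁻¹ ^ (p - 1)) := by
          rw [Real.mul_rpow (by positivity) (by positivity), div_eq_mul_inv d l,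
            Real.mul_rpow hd (by positivity), hpow]
          field_simp
      _ ≤ _ := by gcongr
  linarith

/-- Intermediate step in the discrete critical Hardy inequality:
`∑_{m≥2} |v(m)-v(1)|^p/(m log^p m) ≤ (p/(p-1))^p ∑_{m≥2} |v(m)-v(m-1)|^p m^{p-1}`. -/
theorem discrete_critical_hardy_intermediate
    (p : ℝ) (hp : 1 < p)
    (v : ℕ → ℝ) (hv : (Function.support v).Finite) :
    ∑' m : ℕ, |v (m + 2) - v 1| ^ p / (((m : ℝ) + 2) * Real.log ((m : ℝ) + 2) ^ p)
      ≤ (p / (p - 1)) ^ p *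
          ∑' m : ℕ, |v (m + 2) - v (m + 1)| ^ p * ((m : ℝ) + 2) ^ (p - 1) := by
  have hq : 0 ≤ p / (p - 1) := div_nonneg (by linarith) (by linarith)
  have hlog (m : ℕ) : 0 ≤ Real.log ((m : ℝ) + 2) :=
    Real.log_nonneg (by linarith [m.cast_nonneg (α := ℝ)])
  have hsummable : Summable fun m : ℕ ↦
      |v (m + 2) - v (m + 1)| ^ p * ((m : ℝ) + 2) ^ (p - 1) := by
    obtain ⟨N, hN⟩ := hv.bddAbove
    have hzero (k : ℕ) (hk : N < k) : v k = 0 := by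
      by_contra hne
      exact absurd (hN hne) (by omega)
    refine summable_of_ne_finset_zero (s := Finset.range N) fun m hm ↦ ?_
    rw [Finset.mem_range, not_lt] at hm
    rw [hzero (m + 2) (by omega), hzero (m + 1) (by omega), sub_zero, abs_zero,
      Real.zero_rpow (by linarith), zero_mul]
  have hpartial (N : ℕ) :
      ∑ m ∈ Finset.range N,
          |v (m + 2) - v 1| ^ p / (((m : ℝ) + 2) * Real.log ((m : ℝ) + 2) ^ p)
        ≤ (p / (p - 1)) ^ p * ∑ m ∈ Finset.range N,
            |v (m + 2) - v (m + 1)| ^ p * ((m : ℝ) + 2) ^ (p - 1)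
          - p / (p - 1) * (Real.log ((N : ℝ) + 1)
            * (|v (N + 1) - v 1| / Real.log ((N : ℝ) + 1)) ^ p) := by
    induction N with
    | zero => simp
    | succ N ih =>
      have step := log_hardy_step hp N (abs_nonneg (v (N + 1) - v 1))
        (abs_nonneg (v (N + 2) - v 1)) (abs_nonneg (v (N + 2) - v (N + 1)))
        (by rintro rfl; simp)
        ((abs_sub_le _ (v (N + 1)) _).trans_eq (add_comm _ _))
      rw [Finset.sum_range_succ, Finset.sum_range_succ]
      have hcast : ((N + 1 : ℕ) : ℝ) + 1 = (N : ℝ) + 2 := by push_cast; ring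
      rw [hcast]
      linarith
  refine Real.tsum_le_of_sum_range_le (fun m ↦ ?_) fun N ↦ (hpartial N).trans ?_
  · have := hlog m
    positivity
  · have hboundary : 0 ≤ Real.log ((N : ℝ) + 1) :=
      Real.log_nonneg (by linarith [N.cast_nonneg (α := ℝ)])
    refine (sub_le_self _ (by positivity)).trans ?_
    gcongr
    exact hsummable.sum_le_tsum _ fun m _ ↦ by positivity
end

section
/- Let 1 < p < ∞. For every X, Y ∈ ℂ with Y ≠ 0 and every t ∈ [0,1], one has the identity |X − t·Y|^p = (1 − t)^{p−1}·(|X|^p − t·|Y|^p) + C_p(X − t·Y, t·(X − Y)) + t·(1 − t)^{p−1}·C_p(Y, Y − X). -/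
open Complex

/-- The homogenized `C_p` identity: for `X, Y ∈ ℂ`, `Y ≠ 0` and `t ∈ [0,1]`,
`|X - tY|^p = (1-t)^{p-1}(|X|^p - t|Y|^p) + C_p(X - tY, t(X-Y)) + t(1-t)^{p-1} C_p(Y, Y-X)`. -/
theorem cp_homogenized_identity
    (p : ℝ) (hp : 1 < p) (X Y : ℂ) (hY : Y ≠ 0) (t : ℝ) (ht : t ∈ Set.Icc (0 : ℝ) 1) :
    ‖X - (t : ℂ) * Y‖ ^ p
      = (1 - t) ^ (p - 1) * (‖X‖ ^ p - t * ‖Y‖ ^ p)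
          + Cp p (X - (t : ℂ) * Y) ((t : ℂ) * (X - Y))
          + t * (1 - t) ^ (p - 1) * Cp p Y (Y - X) := by
  obtain ⟨ht0, ht1⟩ := ht
  have hs : 0 ≤ 1 - t := sub_nonneg.2 ht1
  have hξ : X - (t : ℂ) * Y - (t : ℂ) * (X - Y) = ((1 - t : ℝ) : ℂ) * X := by
    push_cast
    ring
  have hnorm : ‖((1 - t : ℝ) : ℂ) * X‖ = (1 - t) * ‖X‖ := by
    rw [norm_mul, Complex.norm_of_nonneg hs]
  have hpow : (1 - t) ^ p = (1 - t) ^ (p - 1) * (1 - t) := by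
    rw [← Real.rpow_add_one' hs (by linarith), sub_add_cancel]
  have hpow' : (1 - t) ^ (p - 1) = (1 - t) ^ (p - 2) * (1 - t) := by
    rw [← Real.rpow_add_one' hs (by linarith)]
    congr 1
    ring
  have hre : (((1 - t : ℝ) : ℂ) * X * (starRingEnd ℂ) ((t : ℂ) * (X - Y))).re
      = -((1 - t) * t * (X * (starRingEnd ℂ) (Y - X)).re) := by
    simp only [map_mul, map_sub, conj_ofReal, mul_re, mul_im, sub_re, sub_im, ofReal_re,
      ofReal_im, conj_re, conj_im]
    ring
  simp only [Cp]
  rw [hξ, hnorm, hre, sub_sub_cancel, Real.mul_rpow hs (norm_nonneg X),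
    Real.mul_rpow hs (norm_nonneg X), hpow, hpow']
  ring
end

section
/- Let 1 < p < ∞ and let φ : ℕ₀ → [0,∞) be positive and non-decreasing on ℕ with φ(0) = 0. Let u : ℕ₀ → ℂ with u(0) = 0, and set ψ(n) := u(n)/φ(n) for n ≥ 1 and ψ(0) := 0. Then for every n ≥ 2 one has the pointwise identity |u(n) − u(n−1)|^p = (φ(n) − φ(n−1))^{p−1}·( φ(n)·|ψ(n)|^p − φ(n−1)·|ψ(n−1)|^p ) + R_p(u(n), φ(n)). -/
open Complex

/-- Peeling one factor off a real power; valid also at `d = 0` because the exponent is not `0`. -/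
theorem rpow_sub_one_mul_self {d q : ℝ} (hd : 0 ≤ d) (hq : q ≠ 0) :
    d ^ (q - 1) * d = d ^ q := by
  simpa using (Real.rpow_add_one' (y := q - 1) hd (by simpa using hq)).symm

/-- The two `Cp` remainders combine: their first-order terms cancel. -/
theorem norm_smul_sub_smul_rpow {p a b : ℝ} (hp : 1 < p) (hab : a ≤ b) (x y : ℂ) :
    ‖(b : ℂ) * x - a * y‖ ^ p
      = (b - a) ^ (p - 1) * (b * ‖x‖ ^ p - a * ‖y‖ ^ p)
        + (Cp p (b * x - a * y) (a * x - a * y) + a * (b - a) ^ (p - 1) * Cp p y (y - x)) := by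
  have hd : 0 ≤ b - a := sub_nonneg.2 hab
  have hξη : (b : ℂ) * x - a * y - (a * x - a * y) = ((b - a : ℝ) : ℂ) * x := by
    push_cast; ring
  have hnorm : ‖((b - a : ℝ) : ℂ) * x‖ = (b - a) * ‖x‖ := by
    rw [norm_mul, Complex.norm_of_nonneg hd]
  have hre : (((b - a : ℝ) : ℂ) * x * (starRingEnd ℂ) (a * x - a * y)).re
      = -((b - a) * (a * (x * (starRingEnd ℂ) (y - x)).re)) := by
    simp only [map_sub, map_mul, conj_ofReal, mul_re, mul_im, sub_re, sub_im, ofReal_re,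
      ofReal_im, conj_re, conj_im]
    ring
  have hpow : (b - a) ^ (p - 1) * (b - a) = (b - a) ^ p :=
    rpow_sub_one_mul_self hd (by linarith)
  have hpow' : (b - a) ^ (p - 2) * (b - a) = (b - a) ^ (p - 1) := by
    rw [← rpow_sub_one_mul_self hd (q := p - 1) (by linarith)]
    ring_nf
  rw [Cp, Cp, hξη, hnorm, hre, sub_sub_cancel, Real.mul_rpow hd (norm_nonneg x),
    Real.mul_rpow hd (norm_nonneg x), ← hpow]
  linear_combination
    -(p * ‖x‖ ^ (p - 2) * (a * (x * (starRingEnd ℂ) (y - x)).re)) * hpow'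

/-- The pointwise identity behind the general weighted discrete `p`-Hardy identity:
with `ψ(n) = u(n)/φ(n)` (and `ψ(0) = 0`), for every `n ≥ 2`,
`|u(n)-u(n-1)|^p = (φ(n)-φ(n-1))^{p-1}(φ(n)|ψ(n)|^p - φ(n-1)|ψ(n-1)|^p) + R_p(u(n),φ(n))`. -/
theorem pointwise_p_hardy_identity
    (p : ℝ) (hp : 1 < p)
    (φ : ℕ → ℝ) (hφ0 : φ 0 = 0) (hφpos : ∀ k, 1 ≤ k → 0 < φ k)
    (hφmono : ∀ k, 1 ≤ k → φ k ≤ φ (k + 1))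
    (u : ℕ → ℂ) (hu0 : u 0 = 0)
    (ψ : ℕ → ℂ) (hψ0 : ψ 0 = 0) (hψ : ∀ k, 1 ≤ k → ψ k = u k / ((φ k : ℝ) : ℂ))
    (n : ℕ) (hn : 2 ≤ n) :
    ‖u n - u (n - 1)‖ ^ p
      = (φ n - φ (n - 1)) ^ (p - 1) *
          (φ n * ‖ψ n‖ ^ p - φ (n - 1) * ‖ψ (n - 1)‖ ^ p)
        + Rp p φ u n := by
  obtain ⟨m, rfl⟩ : ∃ m, n = m + 1 := ⟨n - 1, by omega⟩
  have hm : 1 ≤ m := by omega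
  have ha : (φ m : ℂ) ≠ 0 := ofReal_ne_zero.2 (hφpos m hm).ne'
  have hb : (φ (m + 1) : ℂ) ≠ 0 := ofReal_ne_zero.2 (hφpos (m + 1) (by omega)).ne'
  have key := norm_smul_sub_smul_rpow hp (hφmono m hm)
    (u (m + 1) / (φ (m + 1) : ℂ)) (u m / (φ m : ℂ))
  rw [mul_div_cancel₀ _ hb, mul_div_cancel₀ _ ha] at key
  rw [Rp, Nat.add_sub_cancel, hψ m hm, hψ (m + 1) (by omega), ofReal_div, div_mul_eq_mul_div,
    ← mul_div_assoc']
  exact key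
end

section
/- Let p ≥ 2. Then for every finitely supported sequence u : ℕ₀ → ℂ with u(0) = 0, one has ∑_{n=1}^∞ |u(n) − u(n−1)|^p − ((p−1)/p)^p · ∑_{n=1}^∞ |u(n)|^p / n^p ≥ c₁(p) · ∑_{n=2}^∞ (n−1)^{p−1} · | u(n)/n^{(p−1)/p} − u(n−1)/(n−1)^{(p−1)/p} |^p. -/
open Complex

/-- The constant `c₁(p)`, the infimum over `(s,t) ≠ (0,0)` of
`([t² + s² + 2s + 1]^{p/2} - 1 - ps)/[t² + s²]^{p/2}`. -/
noncomputable def cOne (p : ℝ) : ℝ :=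
  sInf ((fun st : ℝ × ℝ =>
    ((st.2 ^ 2 + st.1 ^ 2 + 2 * st.1 + 1) ^ (p / 2) - 1 - p * st.1) /
      (st.2 ^ 2 + st.1 ^ 2) ^ (p / 2)) '' {st : ℝ × ℝ | st ≠ 0})

theorem cOne_le_div {p : ℝ} (hp : 2 ≤ p) {s t : ℝ} (h : 0 < t ^ 2 + s ^ 2) :
    cOne p ≤ ((t ^ 2 + s ^ 2 + 2 * s + 1) ^ (p / 2) - 1 - p * s) / (t ^ 2 + s ^ 2) ^ (p / 2) := by
  refine csInf_le ⟨0, ?_⟩ ⟨(s, t), ?_, rfl⟩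
  · rintro _ ⟨⟨s, t⟩, -, rfl⟩
    have bernoulli := one_add_mul_self_le_rpow_one_add (s := t ^ 2 + s ^ 2 + 2 * s)
      (by nlinarith [sq_nonneg t, sq_nonneg (s + 1)]) (p := p / 2) (by linarith)
    refine div_nonneg ?_ (by positivity)
    rw [add_comm (1 : ℝ) (t ^ 2 + s ^ 2 + 2 * s)] at bernoulli
    have : 0 ≤ p / 2 * (t ^ 2 + s ^ 2) := by positivity
    dsimp only
    linarith
  · rintro h0
    obtain ⟨rfl, rfl⟩ := Prod.mk.inj h0
    norm_num at h

theorem cOne_le_one {p : ℝ} (hp : 2 ≤ p) : cOne p ≤ 1 := by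
  obtain ⟨y, hy, hlarge⟩ : ∃ y : ℝ, 0 < y ∧ p - 1 ≤ p / 2 * y ^ (p / 2 - 1) := by
    rcases hp.eq_or_lt with rfl | hp'
    · exact ⟨1, one_pos, by norm_num⟩
    · refine ⟨2 ^ (p / 2 - 1)⁻¹, by positivity, ?_⟩
      rw [← Real.rpow_mul (by norm_num), inv_mul_cancel₀ (by linarith), Real.rpow_one]
      linarith
  have bernoulli := one_add_mul_self_le_rpow_one_add (s := y⁻¹)
    (by linarith [inv_pos.2 hy]) (p := p / 2) (by linarith)
  have hs : √y ^ 2 = y := Real.sq_sqrt hy.le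
  refine (cOne_le_div hp (s := -1) (t := √y) (by positivity)).trans ?_
  rw [div_le_one (by positivity), hs]
  have e1 : y + (-1) ^ 2 + 2 * (-1) + 1 = y := by ring
  have e2 : y + (-1) ^ 2 = y * (1 + y⁻¹) := by field_simp
  rw [e1, e2, Real.mul_rpow hy.le (by positivity)]
  have key := mul_le_mul_of_nonneg_left bernoulli (Real.rpow_nonneg hy.le (p / 2))
  rw [Real.rpow_sub_one hy.ne'] at hlarge
  have e3 : y ^ (p / 2) * (1 + p / 2 * y⁻¹) = y ^ (p / 2) + p / 2 * (y ^ (p / 2) / y) := by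
    field_simp
  linarith

theorem norm_rpow_eq_normSq_rpow (z : ℂ) (p : ℝ) :
    ‖z‖ ^ p = (z.im ^ 2 + z.re ^ 2) ^ (p / 2) := by
  rw [add_comm, ← Complex.sq_norm_sub_sq_im, sub_add_cancel, ← Real.rpow_natCast,
    ← Real.rpow_mul (norm_nonneg z)]
  congr 1
  push_cast
  ring

theorem one_add_mul_re_add_cOne_mul_le {p : ℝ} (hp : 2 ≤ p) (z : ℂ) :
    1 + p * z.re + cOne p * ‖z‖ ^ p ≤ ‖1 + z‖ ^ p := by
  rcases eq_or_ne z 0 with rfl | hz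
  · simp [Real.zero_rpow (by linarith : p ≠ 0)]
  · have hpos : 0 < z.im ^ 2 + z.re ^ 2 := by
      have := Complex.normSq_pos.2 hz
      rw [Complex.normSq_apply] at this
      linarith
    have h := cOne_le_div hp hpos
    rw [le_div_iff₀ (by positivity)] at h
    rw [norm_rpow_eq_normSq_rpow z, norm_rpow_eq_normSq_rpow (1 + z)]
    have e : (1 + z).im ^ 2 + (1 + z).re ^ 2 = z.im ^ 2 + z.re ^ 2 + 2 * z.re + 1 := by
      simp
      ring
    rw [e]
    linarith

/-- Quantitative convexity of `‖·‖ ^ p` on `ℂ`. -/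
theorem norm_rpow_add_cOne_mul_le {p : ℝ} (hp : 2 ≤ p) (a b : ℂ) :
    ‖a‖ ^ p + p * ‖a‖ ^ (p - 2) * (starRingEnd ℂ a * b).re + cOne p * ‖b‖ ^ p
      ≤ ‖a + b‖ ^ p := by
  rcases eq_or_ne a 0 with rfl | ha
  · have h := mul_le_mul_of_nonneg_right (cOne_le_one hp) (by positivity : 0 ≤ ‖b‖ ^ p)
    simpa [Real.zero_rpow (by linarith : p ≠ 0)] using h
  · have hpos : 0 < ‖a‖ := norm_pos_iff.2 ha
    have h := mul_le_mul_of_nonneg_left (one_add_mul_re_add_cOne_mul_le hp (b / a))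
      (by positivity : 0 ≤ ‖a‖ ^ p)
    have e1 : ‖a‖ ^ p * ‖1 + b / a‖ ^ p = ‖a + b‖ ^ p := by
      rw [← Real.mul_rpow (norm_nonneg _) (norm_nonneg _), ← norm_mul]
      congr 2
      field_simp
    have e2 : ‖a‖ ^ p * ‖b / a‖ ^ p = ‖b‖ ^ p := by
      rw [← Real.mul_rpow (norm_nonneg _) (norm_nonneg _), ← norm_mul]
      congr 2
      field_simp
    have e3 : ‖a‖ ^ p * (b / a).re = ‖a‖ ^ (p - 2) * (starRingEnd ℂ a * b).re := by
      have : ‖a‖ ^ p = ‖a‖ ^ (p - 2) * ‖a‖ ^ 2 := by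
        rw [← Real.rpow_natCast, ← Real.rpow_add hpos]
        norm_num
      rw [this, mul_assoc]
      congr 1
      rw [← Complex.re_ofReal_mul]
      congr 1
      rw [Complex.ofReal_pow, ← Complex.conj_mul']
      field_simp
    rw [e1] at h
    calc _ = ‖a‖ ^ p + p * (‖a‖ ^ p * (b / a).re) + cOne p * (‖a‖ ^ p * ‖b / a‖ ^ p) := by
          rw [e2, e3]; ring
      _ = ‖a‖ ^ p * (1 + p * (b / a).re + cOne p * ‖b / a‖ ^ p) := by ring
      _ ≤ _ := h

theorem norm_rpow_mul_re_conj_mul_le {p : ℝ} (hp : 2 ≤ p) (v w : ℂ) :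
    p * (‖v‖ ^ (p - 2) * (starRingEnd ℂ v * w).re) ≤ (p - 1) * ‖v‖ ^ p + ‖w‖ ^ p := by
  rcases eq_or_ne v 0 with rfl | hv
  · simp only [map_zero, zero_mul, Complex.zero_re, mul_zero, norm_zero,
      Real.zero_rpow (by linarith : p ≠ 0), zero_add]
    positivity
  · have hpos : 0 < ‖v‖ := norm_pos_iff.2 hv
    have hre : (starRingEnd ℂ v * w).re ≤ ‖v‖ * ‖w‖ := by
      simpa using Complex.re_le_norm (starRingEnd ℂ v * w)
    have young := Real.young_inequality_of_nonneg (a := ‖v‖ ^ (p - 1)) (b := ‖w‖)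
      (by positivity) (norm_nonneg w)
      (Real.HolderConjugate.conjExponent (by linarith : 1 < p)).symm
    rw [← Real.rpow_mul hpos.le, Real.conjExponent,
      mul_div_cancel₀ p (by linarith : p - 1 ≠ 0)] at young
    have e : ‖v‖ ^ (p - 1) = ‖v‖ ^ (p - 2) * ‖v‖ := by
      rw [← Real.rpow_add_one hpos.ne']
      ring_nf
    have h := mul_le_mul_of_nonneg_left hre (by positivity : 0 ≤ ‖v‖ ^ (p - 2))
    rw [e] at young
    calc _ ≤ p * (‖v‖ ^ p / (p / (p - 1)) + ‖w‖ ^ p / p) := by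
          gcongr
          linarith
      _ = _ := by field_simp

/-- Picone-type inequality for one edge of the ground state representation. -/
theorem edge_le_norm_rpow {p : ℝ} (hp : 2 ≤ p) {d f : ℝ} (hd : 0 < d) (hf : 0 ≤ f) (v w : ℂ) :
    d ^ (p - 1) * ((d + f) * ‖v‖ ^ p - f * ‖w‖ ^ p) + cOne p * (f ^ p * ‖v - w‖ ^ p)
      ≤ ‖((d + f : ℝ) : ℂ) * v - (f : ℂ) * w‖ ^ p := by
  have h := norm_rpow_add_cOne_mul_le hp ((d : ℂ) * v) ((f : ℂ) * (v - w))
  have e1 : (d : ℂ) * v + (f : ℂ) * (v - w) = ((d + f : ℝ) : ℂ) * v - (f : ℂ) * w := by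
    push_cast
    ring
  have e2 : (starRingEnd ℂ ((d : ℂ) * v) * ((f : ℂ) * (v - w))).re
      = d * f * (‖v‖ ^ 2 - (starRingEnd ℂ v * w).re) := by
    rw [Complex.sq_norm, Complex.normSq_apply]
    simp
    ring
  have e3 : d ^ (p - 1) = d ^ (p - 2) * d := by
    rw [← Real.rpow_add_one hd.ne']
    ring_nf
  have e4 : d ^ p = d ^ (p - 1) * d := by
    rw [← Real.rpow_add_one hd.ne']
    ring_nf
  have e5 : ‖v‖ ^ (p - 2) * ‖v‖ ^ 2 = ‖v‖ ^ p := by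
    rw [← Real.rpow_natCast, ← Real.rpow_add_of_nonneg (norm_nonneg v) (by linarith) (by simp)]
    norm_num
  rw [e1, e2, norm_mul, norm_mul, Complex.norm_real, Complex.norm_real,
    Real.norm_of_nonneg hd.le, Real.norm_of_nonneg hf, Real.mul_rpow hd.le (norm_nonneg _),
    Real.mul_rpow hd.le (norm_nonneg _), Real.mul_rpow hf (norm_nonneg _)] at h
  refine le_trans ?_ h
  have young := mul_le_mul_of_nonneg_left (norm_rpow_mul_re_conj_mul_le hp v w)
    (by positivity : 0 ≤ d ^ (p - 1) * f)
  have e6 : p * (d ^ (p - 2) * ‖v‖ ^ (p - 2)) * (d * f * (‖v‖ ^ 2 - (starRingEnd ℂ v * w).re))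
      = d ^ (p - 1) * f * (p * ‖v‖ ^ p)
        - d ^ (p - 1) * f * (p * (‖v‖ ^ (p - 2) * (starRingEnd ℂ v * w).re)) := by
    rw [e3, ← e5]
    ring
  rw [e6, e4]
  linarith

theorem hasDerivAt_one_sub_rpow (r : ℝ) {y : ℝ} (hy : y < 1) :
    HasDerivAt (fun y : ℝ => (1 - y) ^ r) (-(r * (1 - y) ^ (r - 1))) y := by
  have h := ((hasDerivAt_id' y).const_sub 1).rpow_const (p := r) (Or.inl (by linarith))
  exact h.congr_deriv (by ring)

theorem hasDerivAt_one_add_rpow (r : ℝ) {y : ℝ} (hy : -1 < y) :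
    HasDerivAt (fun y : ℝ => (1 + y) ^ r) (r * (1 + y) ^ (r - 1)) y := by
  have h := ((hasDerivAt_id' y).const_add 1).rpow_const (p := r) (Or.inl (by linarith))
  exact h.congr_deriv (by ring)

theorem mul_sq_le_one_sub_rpow_mul {q x : ℝ} (hq0 : 0 < q) (hq1 : q ≤ 1) (hx0 : 0 < x)
    (hx1 : x < 1) :
    (q * x) ^ 2 ≤ (1 - (1 - x) ^ q) * ((1 + x) ^ q - 1) := by
  have hmono : MonotoneOn (fun y : ℝ => √((1 - (1 - y) ^ q) * ((1 + y) ^ q - 1)) - q * y)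
      (Set.Icc 0 x) := by
    have hα : ∀ y ∈ Set.Ioo 0 x, 0 < 1 - (1 - y) ^ q := fun y hy =>
      sub_pos.2 (Real.rpow_lt_one (by linarith [hy.2]) (by linarith [hy.1]) hq0)
    have hβ : ∀ y ∈ Set.Ioo 0 x, 0 < (1 + y) ^ q - 1 := fun y hy =>
      sub_pos.2 (Real.one_lt_rpow (by linarith [hy.1]) hq0)
    have hderiv : ∀ y ∈ Set.Ioo 0 x, HasDerivAt
        (fun y : ℝ => √((1 - (1 - y) ^ q) * ((1 + y) ^ q - 1)) - q * y)
        (((q * (1 - y) ^ (q - 1)) * ((1 + y) ^ q - 1)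
          + (1 - (1 - y) ^ q) * (q * (1 + y) ^ (q - 1)))
          / (2 * √((1 - (1 - y) ^ q) * ((1 + y) ^ q - 1))) - q) y := by
      intro y hy
      have hα' := (hasDerivAt_one_sub_rpow q (by linarith [hy.2] : y < 1)).const_sub 1
      have hβ' := (hasDerivAt_one_add_rpow q (by linarith [hy.1] : -1 < y)).sub_const 1
      rw [neg_neg] at hα'
      exact (((hα'.mul hβ').sqrt (mul_pos (hα y hy) (hβ y hy)).ne').sub
        ((hasDerivAt_id' y).const_mul q)).congr_deriv (by simp)
    refine monotoneOn_of_deriv_nonneg (convex_Icc 0 x) ?_ ?_ ?_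
    · have h1 : ContinuousOn (fun y : ℝ => (1 - y) ^ q) (Set.Icc 0 x) :=
        ContinuousOn.rpow_const (by fun_prop) fun _ _ => Or.inr hq0.le
      have h2 : ContinuousOn (fun y : ℝ => (1 + y) ^ q) (Set.Icc 0 x) :=
        ContinuousOn.rpow_const (by fun_prop) fun _ _ => Or.inr hq0.le
      fun_prop
    · rw [interior_Icc]
      exact fun y hy => (hderiv y hy).differentiableAt.differentiableWithinAt
    · rw [interior_Icc]
      intro y hy
      rw [(hderiv y hy).deriv, sub_nonneg]
      have ha := hα y hy
      have hb := hβ y hy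
      have hy1 : 0 < 1 - y := by linarith [hy.2]
      have hy2 : 0 < 1 + y := by linarith [hy.1]
      have hprod : 1 ≤ (1 - y) ^ (q - 1) * (1 + y) ^ (q - 1) := by
        rw [← Real.mul_rpow hy1.le hy2.le]
        exact Real.one_le_rpow_of_pos_of_le_one_of_nonpos (by positivity)
          (by nlinarith [sq_nonneg y]) (by linarith)
      set a := 1 - (1 - y) ^ q
      set b := (1 + y) ^ q - 1
      set a' := (1 - y) ^ (q - 1)
      set b' := (1 + y) ^ (q - 1)
      rw [le_div_iff₀ (by positivity)]
      have : 2 * √(a * b) ≤ a' * b + a * b' := by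
        have ha' : 0 < a' := by positivity
        have hb' : 0 < b' := by positivity
        rw [← abs_of_pos (by positivity : 0 < a' * b + a * b'), ← abs_of_nonneg
          (by positivity : 0 ≤ 2 * √(a * b)), ← sq_le_sq, mul_pow, Real.sq_sqrt (by positivity)]
        nlinarith [sq_nonneg (a' * b - a * b'),
          mul_le_mul_of_nonneg_left hprod (by positivity : 0 ≤ a * b)]
      nlinarith
  have h := hmono (Set.left_mem_Icc.2 hx0.le) (Set.right_mem_Icc.2 hx0.le) hx0.le
  simp only [sub_zero, Real.one_rpow, sub_self, add_zero, mul_zero, Real.sqrt_zero,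
    sub_nonneg] at h
  exact (Real.le_sqrt' (by positivity)).1 h

theorem one_sub_rpow_mul_add_one_add_rpow_mul_le {q x : ℝ} (hq0 : 0 < q) (hq1 : q ≤ 1)
    (hx0 : 0 < x) (hx1 : x < 1) :
    (1 - x) ^ q * (1 - (1 - q) * x / 2) + (1 + x) ^ q * (1 + (1 - q) * x / 2) ≤ 2 := by
  have hlin : ∀ y c : ℝ, HasDerivAt (fun y : ℝ => 1 + c * y) c y := fun y c => by
    simpa using ((hasDerivAt_id y).const_mul c).const_add 1
  set k := (1 - q) / 2 with hk
  let E : ℝ → ℝ := fun y => (1 - y) ^ q * (1 + (-k) * y) + (1 + y) ^ q * (1 + k * y)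
  let E' : ℝ → ℝ := fun y => -(q * (1 - y) ^ (q - 1)) * (1 + (-k) * y) + (1 - y) ^ q * (-k)
    + (q * (1 + y) ^ (q - 1) * (1 + k * y) + (1 + y) ^ q * k)
  have hE : ∀ y ∈ Set.Ioo (-1 : ℝ) 1, HasDerivAt E (E' y) y := fun y hy =>
    ((hasDerivAt_one_sub_rpow q hy.2).mul (hlin y _)).add ((hasDerivAt_one_add_rpow q hy.1).mul (hlin y _))
  have hE' : ∀ y ∈ Set.Ioo (-1 : ℝ) 1, HasDerivAt E'
      (q * (1 - q) * (1 - k) * y * ((1 + y) ^ (q - 2) - (1 - y) ^ (q - 2))) y := by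
    intro y hy
    have h := ((((hasDerivAt_one_sub_rpow (q - 1) hy.2).const_mul q).neg.mul (hlin y (-k))).add
      ((hasDerivAt_one_sub_rpow q hy.2).mul_const (-k))).add
      ((((hasDerivAt_one_add_rpow (q - 1) hy.1).const_mul q).mul (hlin y k)).add ((hasDerivAt_one_add_rpow q hy.1).mul_const k))
    refine h.congr_deriv ?_
    have hy1 : 0 < 1 - y := by linarith [hy.2]
    have hy2 : 0 < 1 + y := by linarith [hy.1]
    have e1 : (1 - y) ^ (q - 1) = (1 - y) ^ (q - 2) * (1 - y) := by
      rw [← Real.rpow_add_one hy1.ne']; ring_nf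
    have e2 : (1 + y) ^ (q - 1) = (1 + y) ^ (q - 2) * (1 + y) := by
      rw [← Real.rpow_add_one hy2.ne']; ring_nf
    rw [Pi.neg_apply, show q - 1 - 1 = q - 2 by ring, e1, e2, hk]
    ring
  have hsub : Set.Icc 0 x ⊆ Set.Ioo (-1 : ℝ) 1 := fun y hy =>
    ⟨by linarith [hy.1], by linarith [hy.2]⟩
  have hint : interior (Set.Icc 0 x) ⊆ Set.Ioo (-1 : ℝ) 1 := interior_subset.trans hsub
  have anti' : AntitoneOn E' (Set.Icc 0 x) := by
    refine antitoneOn_of_deriv_nonpos (convex_Icc 0 x)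
      (fun y hy => (hE' y (hsub hy)).continuousAt.continuousWithinAt)
      (fun y hy => (hE' y (hint hy)).differentiableAt.differentiableWithinAt) fun y hy => ?_
    rw [(hE' y (hint hy)).deriv]
    have hy' := interior_subset hy
    have hle : (1 + y) ^ (q - 2) ≤ (1 - y) ^ (q - 2) :=
      Real.rpow_le_rpow_of_nonpos (by linarith [hy'.2]) (by linarith [hy'.1]) (by linarith)
    have h1 : 0 ≤ 1 - q := by linarith
    have h2 : 0 ≤ 1 - k := by linarith
    have h3 := hy'.1
    exact mul_nonpos_of_nonneg_of_nonpos (by positivity) (by linarith)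
  have anti : AntitoneOn E (Set.Icc 0 x) := by
    refine antitoneOn_of_deriv_nonpos (convex_Icc 0 x)
      (fun y hy => (hE y (hsub hy)).continuousAt.continuousWithinAt)
      (fun y hy => (hE y (hint hy)).differentiableAt.differentiableWithinAt) fun y hy => ?_
    rw [(hE y (hint hy)).deriv]
    have hy' := interior_subset hy
    refine (anti' (Set.left_mem_Icc.2 hx0.le) hy' hy'.1).trans_eq ?_
    simp only [E', sub_zero, add_zero, Real.one_rpow]
    ring
  have h := anti (Set.left_mem_Icc.2 hx0.le) (Set.right_mem_Icc.2 hx0.le) hx0.le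
  simp only [E, sub_zero, add_zero, Real.one_rpow, mul_zero] at h
  have e1 : (1 - q) * x / 2 = k * x := by rw [hk]; ring
  rw [e1]
  linarith

theorem two_mul_le_log_sub_log {z : ℝ} (hz0 : 0 ≤ z) (hz1 : z < 1) :
    2 * z ≤ Real.log (1 + z) - Real.log (1 - z) := by
  have h := le_hasSum (Real.hasSum_log_sub_log_of_abs_lt_one (abs_lt.2 ⟨by linarith, hz1⟩)) 0
    fun _ _ => by positivity
  simpa using h

theorem le_exp_sub_exp {x a b : ℝ} (hx : 0 ≤ x) (hsum : 0 ≤ a + b) (hdiff : x ≤ a - b) :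
    x ≤ Real.exp a - Real.exp b := by
  have e : Real.exp a - Real.exp b
      = Real.exp ((a + b) / 2) * (2 * Real.sinh ((a - b) / 2)) := by
    rw [Real.sinh_eq, mul_div_cancel₀ _ two_ne_zero, mul_sub, ← Real.exp_add, ← Real.exp_add]
    ring_nf
  have h1 : (a - b) / 2 ≤ Real.sinh ((a - b) / 2) := Real.self_le_sinh_iff.2 (by linarith)
  have h2 : 1 ≤ Real.exp ((a + b) / 2) := Real.one_le_exp (by linarith)
  rw [e]
  nlinarith

theorem mul_rpow_le_rpow_mul_sub {p q x : ℝ} (hp : 2 ≤ p) (hq : q = (p - 1) / p) (hx0 : 0 < x)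
    (hx1 : x < 1) :
    x * (q * x) ^ (p - 2) ≤ (1 - (1 - x) ^ q) ^ (p - 2) * (1 - x) ^ (q - 1)
      - ((1 + x) ^ q - 1) ^ (p - 2) * (1 + x) ^ (q - 1) := by
  have hq0 : 0 < q := hq ▸ div_pos (by linarith) (by linarith)
  have hqp : q - 1 = -(1 / p) := by rw [hq]; field_simp; ring
  have hk0 : 0 < 1 / p := by positivity
  have hk1 : 1 / p ≤ 1 := (div_le_one (by linarith)).2 (by linarith)
  have hxm : 0 < 1 - x := by linarith
  have hα : 0 < 1 - (1 - x) ^ q :=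
    sub_pos.2 (Real.rpow_lt_one hxm.le (by linarith) hq0)
  have hβ : 0 < (1 + x) ^ q - 1 := sub_pos.2 (Real.one_lt_rpow (by linarith) hq0)
  have hprod := mul_sq_le_one_sub_rpow_mul hq0 (by linarith) hx0 hx1
  have hratio := one_sub_rpow_mul_add_one_add_rpow_mul_le hq0 (by linarith) hx0 hx1
  rw [show 1 - q = 1 / p by linarith] at hratio
  set α := 1 - (1 - x) ^ q with hα_def
  set β := (1 + x) ^ q - 1 with hβ_def
  set z := 1 / p * x / 2 with hz
  have hz0 : 0 < z := by positivity
  have hz1 : z < 1 := by nlinarith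
  have hzm : 0 < 1 - z := by linarith
  have hlogprod : 2 * Real.log (q * x) ≤ Real.log α + Real.log β := by
    rw [← Real.log_mul hα.ne' hβ.ne']
    simpa using Real.log_le_log (by positivity) hprod
  have hlogratio : Real.log β + Real.log (1 + z) ≤ Real.log α + Real.log (1 - z) := by
    rw [← Real.log_mul hα.ne' hzm.ne', ← Real.log_mul hβ.ne' (by positivity)]
    refine Real.log_le_log (by positivity) ?_
    rw [hα_def, hβ_def]
    linarith
  have hz2 := two_mul_le_log_sub_log hz0.le hz1
  have hx2 := two_mul_le_log_sub_log hx0.le hx1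
  have hlogsq : Real.log (1 - x) + Real.log (1 + x) ≤ 0 := by
    rw [← Real.log_mul hxm.ne' (by positivity)]
    exact Real.log_nonpos (by positivity) (by nlinarith)
  have key := le_exp_sub_exp
    (a := (p - 2) * (Real.log α - Real.log (q * x)) - 1 / p * Real.log (1 - x))
    (b := (p - 2) * (Real.log β - Real.log (q * x)) - 1 / p * Real.log (1 + x)) hx0.le
    (by
      have h1 : 0 ≤ (p - 2) * (Real.log α + Real.log β - 2 * Real.log (q * x)) :=
        mul_nonneg (by linarith) (by linarith)
      have h2 := mul_nonpos_of_nonneg_of_nonpos hk0.le hlogsq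
      linarith)
    (by
      have h1 : (p - 2) * (2 * z) ≤ (p - 2) * (Real.log α - Real.log β) :=
        mul_le_mul_of_nonneg_left (by linarith) (by linarith)
      have h2 := mul_le_mul_of_nonneg_left hx2 hk0.le
      have h3 : (p - 2) * (2 * z) + 1 / p * (2 * x) = x := by
        rw [hz]
        field_simp
        ring
      linarith)
  refine (mul_le_mul_of_nonneg_right key (by positivity : 0 ≤ (q * x) ^ (p - 2))).trans_eq ?_
  rw [hqp, Real.rpow_def_of_pos (by positivity : 0 < q * x), Real.rpow_def_of_pos hα,
    Real.rpow_def_of_pos hβ, Real.rpow_def_of_pos hxm, Real.rpow_def_of_pos (by positivity),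
    sub_mul]
  simp only [← Real.exp_add]
  ring_nf

/-- Pointwise lower bound for the `p`-Hardy weight generated by `n ↦ n ^ ((p - 1) / p)`, with
`x = 1 / n`. -/
theorem mul_rpow_le_one_sub_rpow_sub {p q x : ℝ} (hp : 2 ≤ p) (hq : q = (p - 1) / p) (hx0 : 0 < x)
    (hx1 : x ≤ 1) :
    q ^ p * x ^ p ≤ (1 - (1 - x) ^ q) ^ (p - 1) - ((1 + x) ^ q - 1) ^ (p - 1) := by
  have hq0 : 0 < q := hq ▸ div_pos (by linarith) (by linarith)
  have hpq : p * q = p - 1 := by rw [hq]; field_simp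
  let H : ℝ → ℝ := fun y =>
    (1 - (1 - y) ^ q) ^ (p - 1) - ((1 + y) ^ q - 1) ^ (p - 1) - q ^ p * y ^ p
  have hderiv : ∀ y ∈ Set.Ioo (0 : ℝ) 1, HasDerivAt H
      ((p - 1) * q * ((1 - (1 - y) ^ q) ^ (p - 2) * (1 - y) ^ (q - 1)
        - ((1 + y) ^ q - 1) ^ (p - 2) * (1 + y) ^ (q - 1) - y * (q * y) ^ (p - 2))) y := by
    intro y hy
    have hy0 := hy.1
    have h1 := ((hasDerivAt_one_sub_rpow q hy.2).const_sub 1).rpow_const (p := p - 1)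
      (Or.inr (by linarith))
    have h2 := ((hasDerivAt_one_add_rpow q (by linarith : -1 < y)).sub_const 1).rpow_const
      (p := p - 1) (Or.inr (by linarith))
    have h3 := (Real.hasDerivAt_rpow_const (x := y) (p := p) (Or.inl hy0.ne')).const_mul (q ^ p)
    refine ((h1.sub h2).sub h3).congr_deriv ?_
    have e1 : q ^ p = q ^ (p - 2) * q * q := by
      rw [← Real.rpow_add_one hq0.ne', ← Real.rpow_add_one hq0.ne']
      ring_nf
    have e2 : y ^ (p - 1) = y ^ (p - 2) * y := by
      rw [← Real.rpow_add_one hy0.ne']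
      ring_nf
    rw [e1, e2, Real.mul_rpow hq0.le hy0.le, show p - 1 - 1 = p - 2 by ring, ← hpq]
    ring
  have hmono : MonotoneOn H (Set.Icc 0 1) := by
    refine monotoneOn_of_deriv_nonneg (convex_Icc 0 1) ?_ ?_ ?_
    · have h1 : ContinuousOn (fun y : ℝ => (1 - y) ^ q) (Set.Icc 0 1) :=
        ContinuousOn.rpow_const (by fun_prop) fun _ _ => Or.inr hq0.le
      have h2 : ContinuousOn (fun y : ℝ => (1 + y) ^ q) (Set.Icc 0 1) :=
        ContinuousOn.rpow_const (by fun_prop) fun _ _ => Or.inr hq0.le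
      have h3 : ContinuousOn (fun y : ℝ => y ^ p) (Set.Icc 0 1) :=
        ContinuousOn.rpow_const (by fun_prop) fun _ _ => Or.inr (by linarith)
      have h4 : ContinuousOn (fun y : ℝ => (1 - (1 - y) ^ q) ^ (p - 1)) (Set.Icc 0 1) :=
        ContinuousOn.rpow_const (by fun_prop) fun _ _ => Or.inr (by linarith)
      have h5 : ContinuousOn (fun y : ℝ => ((1 + y) ^ q - 1) ^ (p - 1)) (Set.Icc 0 1) :=
        ContinuousOn.rpow_const (by fun_prop) fun _ _ => Or.inr (by linarith)
      fun_prop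
    · rw [interior_Icc]
      exact fun y hy => (hderiv y hy).differentiableAt.differentiableWithinAt
    · rw [interior_Icc]
      intro y hy
      rw [(hderiv y hy).deriv]
      refine mul_nonneg (mul_nonneg (by linarith) hq0.le) ?_
      linarith [mul_rpow_le_rpow_mul_sub hp hq hy.1 hy.2]
  have h := hmono (Set.left_mem_Icc.2 zero_le_one) ⟨hx0.le, hx1⟩ hx0.le
  simp only [H, sub_zero, add_zero, Real.one_rpow, sub_self,
    Real.zero_rpow (by linarith : p - 1 ≠ 0), Real.zero_rpow (by linarith : p ≠ 0), mul_zero] at h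
  linarith

theorem sum_range_mul_sub_succ (D G : ℕ → ℝ) (hG : G 0 = 0) (N : ℕ) :
    ∑ i ∈ Finset.range N, D i * (G (i + 1) - G i)
      = ∑ i ∈ Finset.range N, (D i - D (i + 1)) * G (i + 1) + D N * G N := by
  induction N with
  | zero => simp [hG]
  | succ N ih =>
    rw [Finset.sum_range_succ, Finset.sum_range_succ, ih]
    ring

theorem hardy_weight_le {p q : ℝ} (hp : 2 ≤ p) (hq : q = (p - 1) / p) (i : ℕ) :
    q ^ p * (((i : ℝ) + 1) ^ q) ^ (p - 1) / ((i : ℝ) + 1) ^ p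
      ≤ (((i : ℝ) + 1) ^ q - (i : ℝ) ^ q) ^ (p - 1)
        - (((i : ℝ) + 2) ^ q - ((i : ℝ) + 1) ^ q) ^ (p - 1) := by
  have hq0 : 0 < q := hq ▸ div_pos (by linarith) (by linarith)
  set m : ℝ := (i : ℝ) + 1 with hm
  have hi : (0 : ℝ) ≤ i := i.cast_nonneg
  have hm1 : 1 ≤ m := by linarith
  have hm0 : 0 < m := by linarith
  have hinv0 : 0 < m⁻¹ := inv_pos.2 hm0
  have hinv1 : m⁻¹ ≤ 1 := inv_le_one_of_one_le₀ hm1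
  have h := mul_le_mul_of_nonneg_left (mul_rpow_le_one_sub_rpow_sub hp hq hinv0 hinv1)
    (by positivity : 0 ≤ (m ^ q) ^ (p - 1))
  have hmq : 0 ≤ m ^ q := by positivity
  have e1 : (i : ℝ) ^ q = m ^ q * (1 - m⁻¹) ^ q := by
    rw [← Real.mul_rpow hm0.le (by linarith)]
    congr 1
    field_simp
    linarith
  have e2 : ((i : ℝ) + 2) ^ q = m ^ q * (1 + m⁻¹) ^ q := by
    rw [← Real.mul_rpow hm0.le (by linarith)]
    congr 1
    field_simp
    linarith
  have hα : 0 ≤ 1 - (1 - m⁻¹) ^ q :=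
    sub_nonneg.2 (Real.rpow_le_one (by linarith) (by linarith) hq0.le)
  have hβ : 0 ≤ (1 + m⁻¹) ^ q - 1 := sub_nonneg.2 (Real.one_le_rpow (by linarith) hq0.le)
  have e3 : m ^ q - m ^ q * (1 - m⁻¹) ^ q = m ^ q * (1 - (1 - m⁻¹) ^ q) := by ring
  have e4 : m ^ q * (1 + m⁻¹) ^ q - m ^ q = m ^ q * ((1 + m⁻¹) ^ q - 1) := by ring
  rw [e1, e2, e3, e4, Real.mul_rpow hmq hα, Real.mul_rpow hmq hβ]
  rw [Real.inv_rpow hm0.le] at h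
  calc _ = (m ^ q) ^ (p - 1) * (q ^ p * (m ^ p)⁻¹) := by ring
    _ ≤ _ := h
    _ = _ := by ring

theorem sum_range_hardy_stability {p q : ℝ} (hp : 2 ≤ p) (hq : q = (p - 1) / p) (u : ℕ → ℂ)
    (hu0 : u 0 = 0) (N : ℕ) :
    cOne p * ∑ i ∈ Finset.range N, (i : ℝ) ^ (p - 1) *
          ‖u (i + 1) / ((((i : ℝ) + 1) ^ q : ℝ) : ℂ) - u i / (((i : ℝ) ^ q : ℝ) : ℂ)‖ ^ p
        + q ^ p * ∑ i ∈ Finset.range N, ‖u (i + 1)‖ ^ p / ((i : ℝ) + 1) ^ p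
      ≤ ∑ i ∈ Finset.range N, ‖u (i + 1) - u i‖ ^ p := by
  have hq0 : 0 < q := hq ▸ div_pos (by linarith) (by linarith)
  have hqp : q * p = p - 1 := by rw [hq]; field_simp
  let φ : ℕ → ℝ := fun n => (n : ℝ) ^ q
  let v : ℕ → ℂ := fun n => u n / (φ n : ℂ)
  let D : ℕ → ℝ := fun n => (φ (n + 1) - φ n) ^ (p - 1)
  have hφ : ∀ n, 0 ≤ φ n := fun n => by positivity
  have hφ_pos : ∀ n, 0 < φ (n + 1) := fun n => by positivity
  have hφ_succ : ∀ n, φ (n + 1) = ((n : ℝ) + 1) ^ q := fun n => by simp [φ]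
  have hφ_lt : ∀ n, 0 < φ (n + 1) - φ n := fun n =>
    sub_pos.2 (Real.rpow_lt_rpow n.cast_nonneg (by simp) hq0)
  have hφv : ∀ n, (φ n : ℂ) * v n = u n := by
    rintro (_ | n)
    · simp [v, hu0]
    · exact mul_div_cancel₀ _ (Complex.ofReal_ne_zero.2 (hφ_pos n).ne')
  have hedge : ∀ i, D i * (φ (i + 1) * ‖v (i + 1)‖ ^ p - φ i * ‖v i‖ ^ p)
      + cOne p * ((i : ℝ) ^ (p - 1) * ‖v (i + 1) - v i‖ ^ p) ≤ ‖u (i + 1) - u i‖ ^ p := by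
    intro i
    have h := edge_le_norm_rpow hp (hφ_lt i) (hφ i) (v (i + 1)) (v i)
    rwa [sub_add_cancel, hφv, hφv, ← Real.rpow_mul i.cast_nonneg, hqp] at h
  have hweight : ∀ i, q ^ p * (‖u (i + 1)‖ ^ p / ((i : ℝ) + 1) ^ p)
      ≤ (D i - D (i + 1)) * (φ (i + 1) * ‖v (i + 1)‖ ^ p) := by
    intro i
    have h := mul_le_mul_of_nonneg_right (hardy_weight_le hp hq i)
      (mul_nonneg (hφ (i + 1)) (by positivity : 0 ≤ ‖v (i + 1)‖ ^ p))
    have e1 : ((i : ℝ) + 2) ^ q = φ (i + 1 + 1) := by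
      rw [hφ_succ]
      push_cast
      ring_nf
    rw [← hφ_succ, e1] at h
    refine le_of_eq_of_le ?_ h
    rw [← hφv (i + 1), norm_mul, Complex.norm_real, Real.norm_of_nonneg (hφ _),
      Real.mul_rpow (hφ _) (norm_nonneg _)]
    have e2 : φ (i + 1) ^ p = φ (i + 1) ^ (p - 1) * φ (i + 1) := by
      rw [← Real.rpow_add_one (hφ_pos i).ne']
      ring_nf
    rw [e2]
    ring
  have abel := sum_range_mul_sub_succ D (fun n => φ n * ‖v n‖ ^ p)
    (by simp [φ, Real.zero_rpow hq0.ne']) N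
  have hlast : 0 ≤ D N * (φ N * ‖v N‖ ^ p) :=
    mul_nonneg (Real.rpow_nonneg (hφ_lt N).le _) (mul_nonneg (hφ N) (by positivity))
  have h1 := Finset.sum_le_sum fun i (_ : i ∈ Finset.range N) => hedge i
  have h2 := Finset.sum_le_sum fun i (_ : i ∈ Finset.range N) => hweight i
  rw [Finset.sum_add_distrib, ← Finset.mul_sum] at h1
  rw [← Finset.mul_sum] at h2
  simp only [v, hφ_succ] at *
  simp only [φ] at *
  linarith

/-- Key intermediate step for the quantitative stability of the discrete `p`-Hardy
inequality: for `p ≥ 2`,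
`∑|u(n)-u(n-1)|^p - ((p-1)/p)^p ∑|u(n)|^p/n^p
  ≥ c₁(p) ∑_{n≥2} (n-1)^{p-1} |u(n)/n^{(p-1)/p} - u(n-1)/(n-1)^{(p-1)/p}|^p`. -/
theorem discrete_p_hardy_stability_intermediate
    (p : ℝ) (hp : 2 ≤ p)
    (u : ℕ → ℂ) (hu : (Function.support u).Finite) (hu0 : u 0 = 0) :
    cOne p *
        ∑' n : ℕ, ((n : ℝ) + 1) ^ (p - 1) *
          ‖u (n + 2) / (((((n : ℝ) + 2) ^ ((p - 1) / p) : ℝ)) : ℂ)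
            - u (n + 1) / (((((n : ℝ) + 1) ^ ((p - 1) / p) : ℝ)) : ℂ)‖ ^ p
      ≤ (∑' n : ℕ, ‖u (n + 1) - u n‖ ^ p)
          - ((p - 1) / p) ^ p * ∑' n : ℕ, ‖u (n + 1)‖ ^ p / ((n : ℝ) + 1) ^ p := by
  have hp0 : p ≠ 0 := by linarith
  obtain ⟨N, hN⟩ : ∃ N : ℕ, ∀ n, N ≤ n → u n = 0 := by
    obtain ⟨M, hM⟩ := hu.bddAbove
    refine ⟨M + 1, fun n hn => by_contra fun h => ?_⟩
    have := hM (Function.mem_support.2 h)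
    omega
  rw [tsum_eq_sum (s := Finset.range N), tsum_eq_sum (s := Finset.range (N + 1)),
    tsum_eq_sum (s := Finset.range (N + 1))]
  · have h := sum_range_hardy_stability hp rfl u hu0 (N + 1)
    rw [Finset.sum_range_succ'] at h
    simp only [Nat.cast_zero, Real.zero_rpow (by linarith : p - 1 ≠ 0), zero_mul, add_zero,
      Nat.cast_add, Nat.cast_one, add_assoc, one_add_one_eq_two] at h ⊢
    linarith
  all_goals
    intro n hn
    simp only [Finset.mem_range, not_lt] at hn
  · simp [hN (n + 1) (by omega), Real.zero_rpow hp0]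
  · simp [hN (n + 1) (by omega), hN n (by omega), Real.zero_rpow hp0]
  · simp [hN (n + 1) (by omega), hN (n + 2) (by omega), Real.zero_rpow hp0]
end
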